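/- Let F ∈ ℤ[t] be an irreducible polynomial of degree g ≥ 2. There exist constants D ≥ 2, M > 0 and c > 0, depending only on F, such that, with λ_j, E_j and 𝒜(b) defined as in the context, the following holds. Let η > 0, let h ≥ 1 and let b = (b₁, …, b_h) be a vector of nonnegative integers, not all zero; set m = min{j : b_j ≥ 1} and k = b_m + ⋯ + b_h. If η < 1, assume additionally that m ≥ M and b_j ≤ 2^{j/2} for every j. Then ∑_{a ∈ 𝒜(b)} W(a; η) ρ(a)/a ≤ ((2 log 2)^k/(b_m! ⋯ b_h!)) · (1.01 + c · η · ∑_{j=m}^{h} 2^{−j + b_m + ⋯ + b_j}). -/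

import Mathlib

open Real MeasureTheory
open scoped Classical

/-- number of residues n mod d with F(n) ≡ 0 (mod d) -/
noncomputable def polyRho (F : Polynomial ℤ) (d : ℕ) : ℕ :=
  ((Finset.range d).filter (fun n => (d : ℤ) ∣ F.eval (n : ℤ))).card

/-- H_F(x,y,z): number of positive n ≤ x with F(n) having a divisor in (y,z] -/
noncomputable def polyH (F : Polynomial ℤ) (x y z : ℝ) : ℕ :=
  {n : ℕ | 0 < n ∧ (n : ℝ) ≤ x ∧
    ∃ d : ℕ, 0 < d ∧ (d : ℤ) ∣ F.eval (n : ℤ) ∧ y < (d : ℝ) ∧ (d : ℝ) ≤ z}.ncard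

/-- H(x,y,z): number of positive n ≤ x having a divisor in (y,z] -/
noncomputable def Hdiv (x y z : ℝ) : ℕ :=
  {n : ℕ | 0 < n ∧ (n : ℝ) ≤ x ∧
    ∃ d : ℕ, 0 < d ∧ d ∣ n ∧ y < (d : ℝ) ∧ (d : ℝ) ≤ z}.ncard

/-- L(a;σ) -/
noncomputable def Lfun (a : ℕ) (σ : ℝ) : ℝ :=
  (volume {x : ℝ | ∃ d : ℕ, d ∣ a ∧ Real.exp x < (d : ℝ) ∧ (d : ℝ) ≤ Real.exp (x + σ)}).toReal

/-- W(a;σ): ordered pairs of divisors near each other -/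
noncomputable def Wfun (a : ℕ) (σ : ℝ) : ℕ :=
  {p : ℕ × ℕ | p.1 ∣ a ∧ p.2 ∣ a ∧ |Real.log ((p.1 : ℝ) / (p.2 : ℝ))| ≤ σ}.ncard

/-- 𝒫(s,t): squarefree integers with all prime factors in (s,t] -/
def Psf (s t : ℝ) : Set ℕ :=
  {a : ℕ | 0 < a ∧ Squarefree a ∧ ∀ p : ℕ, p.Prime → p ∣ a → s < (p : ℝ) ∧ (p : ℝ) ≤ t}

/-- φ_F(n) = n ∏_{p|n} (1 - ρ(p)/p) -/
noncomputable def polyPhi (F : Polynomial ℤ) (n : ℕ) : ℝ :=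
  (n : ℝ) * ∏ p ∈ n.primeFactors, (1 - (polyRho F p : ℝ) / p)

/-- P⁺(n): largest prime factor, P⁺(1)=0 -/
def Pplus (n : ℕ) : ℕ := n.primeFactors.sup id

/-- h(n;X): least prime q with ∏_{p^ν ∥ n, p ≤ q} p^ν > √X -/
noncomputable def hfun (n : ℕ) (X : ℝ) : ℕ :=
  sInf {q : ℕ | q.Prime ∧
    Real.sqrt X < ∏ p ∈ n.primeFactors.filter (fun p => p ≤ q), (p : ℝ) ^ (n.factorization p)}


/-- 𝒜(b): squarefree integers with exactly b j prime factors in E_j = (λ_{j-1}, λ_j] for 1 ≤ j ≤ h,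
and all prime factors in E_1 ∪ ⋯ ∪ E_h -/
def Aset (lam : ℕ → ℕ) (h : ℕ) (b : ℕ → ℕ) : Set ℕ :=
  {a : ℕ | 0 < a ∧ Squarefree a ∧
    (∀ p ∈ a.primeFactors, lam 0 < p ∧ p ≤ lam h) ∧
    ∀ j ∈ Finset.Icc 1 h,
      ((a.primeFactors).filter (fun p => lam (j - 1) < p ∧ p ≤ lam j)).card = b j}

/-! ### An upper-bound sieve for primes in short intervals -/

section Sieve

open Finset ArithmeticFunction
open scoped ArithmeticFunction.Moebius

/-- The squarefree integers in `[1, z]`. -/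
noncomputable def sqfreeUpTo (z : ℕ) : Finset ℕ := (Icc 1 z).filter Squarefree

/-- The sum of the reciprocals of the squarefree integers in `[1, z]`. -/
noncomputable def sqfreeHarmonic (z : ℕ) : ℝ := ∑ e ∈ sqfreeUpTo z, (1 : ℝ) / e

/-- The weights of the `Λ²` sieve of level `z`. -/
noncomputable def sieveWeight (z d : ℕ) : ℝ :=
  (μ d : ℝ) * d * (∑ e ∈ (sqfreeUpTo z).filter (d ∣ ·), (1 : ℝ) / e) / sqfreeHarmonic z

lemma mem_sqfreeUpTo {z d : ℕ} : d ∈ sqfreeUpTo z ↔ 1 ≤ d ∧ d ≤ z ∧ Squarefree d := by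
  simp [sqfreeUpTo, and_assoc]

lemma sqfreeHarmonic_pos {z : ℕ} (hz : 1 ≤ z) : 0 < sqfreeHarmonic z := by
  apply sum_pos
  · intro e he
    have := (mem_sqfreeUpTo.1 he).1
    positivity
  · exact ⟨1, mem_sqfreeUpTo.2 ⟨le_rfl, hz, squarefree_one⟩⟩

lemma sieveWeight_one {z : ℕ} (hz : 1 ≤ z) : sieveWeight z 1 = 1 := by
  have := (sqfreeHarmonic_pos hz).ne'
  unfold sieveWeight
  simp only [one_dvd, filter_true]
  rw [← sqfreeHarmonic]
  simp [this]

lemma abs_sieveWeight_le {z d : ℕ} (hz : 1 ≤ z) (hd : d ≤ z) : |sieveWeight z d| ≤ z := by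
  have hG := sqfreeHarmonic_pos hz
  have h1 : (∑ e ∈ (sqfreeUpTo z).filter (d ∣ ·), (1 : ℝ) / e) ≤ sqfreeHarmonic z :=
    sum_le_sum_of_subset_of_nonneg (filter_subset _ _) fun _ _ _ ↦ by positivity
  have h0 : 0 ≤ (∑ e ∈ (sqfreeUpTo z).filter (d ∣ ·), (1 : ℝ) / e) :=
    sum_nonneg fun _ _ ↦ by positivity
  have hmu : |(μ d : ℝ)| ≤ 1 := by exact_mod_cast abs_moebius_le_one
  unfold sieveWeight
  rw [abs_div, abs_mul, abs_mul, abs_of_pos hG, abs_of_nonneg h0, Nat.abs_cast, div_le_iff₀ hG]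
  gcongr
  calc |(μ d : ℝ)| * d ≤ 1 * z := by gcongr
    _ = z := one_mul _

lemma sum_moebius_between {z l e : ℕ} (he : e ∈ sqfreeUpTo z) :
    ∑ d ∈ (sqfreeUpTo z).filter (fun d ↦ l ∣ d ∧ d ∣ e), (μ d : ℝ) =
      if l = e then (μ e : ℝ) else 0 := by
  obtain ⟨he1, hez, hes⟩ := mem_sqfreeUpTo.1 he
  by_cases hle : l ∣ e
  · obtain ⟨f, rfl⟩ := hle
    have hl0 : 0 < l := Nat.pos_of_ne_zero fun h ↦ by simp [h] at he1
    have hf0 : 0 < f := Nat.pos_of_ne_zero fun h ↦ by simp [h] at he1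
    have hcop : l.Coprime f := Nat.coprime_of_squarefree_mul hes
    have hset : (sqfreeUpTo z).filter (fun d ↦ l ∣ d ∧ d ∣ l * f) =
        f.divisors.image (l * ·) := by
      ext d
      simp only [mem_filter, mem_sqfreeUpTo, mem_image, Nat.mem_divisors]
      constructor
      · rintro ⟨-, ⟨k, rfl⟩, h2⟩
        exact ⟨k, ⟨Nat.dvd_of_mul_dvd_mul_left hl0 h2, hf0.ne'⟩, rfl⟩
      · rintro ⟨k, ⟨hk, -⟩, rfl⟩
        have hd : l * k ∣ l * f := Nat.mul_dvd_mul_left l hk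
        exact ⟨⟨Nat.pos_of_dvd_of_pos hd he1, (Nat.le_of_dvd he1 hd).trans hez,
          hes.squarefree_of_dvd hd⟩, Dvd.intro _ rfl, hd⟩
    rw [hset, sum_image (fun a _ b _ h ↦ Nat.eq_of_mul_eq_mul_left hl0 h)]
    have hmul : ∀ k ∈ f.divisors, ((μ (l * k) : ℤ) : ℝ) = μ l * μ k := by
      intro k hk
      rw [isMultiplicative_moebius.map_mul_of_coprime
        (hcop.coprime_dvd_right (Nat.dvd_of_mem_divisors hk))]
      push_cast; ring
    rw [sum_congr rfl hmul, ← mul_sum]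
    have hsum : ∑ k ∈ f.divisors, (μ k : ℝ) = if f = 1 then 1 else 0 := by
      have := congrArg (fun g : ArithmeticFunction ℤ ↦ g f) moebius_mul_coe_zeta
      simp only [one_apply, coe_mul_zeta_apply] at this
      exact_mod_cast congrArg (fun n : ℤ ↦ (n : ℝ)) this
    rw [hsum]
    by_cases hf : f = 1
    · simp [hf]
    · have : l ≠ l * f := fun h ↦ hf (Nat.eq_of_mul_eq_mul_left hl0 (by simpa using h.symm))
      simp [hf, this]
  · have : l ≠ e := fun h ↦ hle (h ▸ dvd_rfl)
    rw [if_neg this, filter_eq_empty_iff.2, sum_empty]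
    exact fun d _ hd ↦ hle (hd.1.trans hd.2)

lemma sum_sieveWeight_div {z : ℕ} (l : ℕ) :
    ∑ d ∈ (sqfreeUpTo z).filter (l ∣ ·), sieveWeight z d / d =
      if l ∈ sqfreeUpTo z then (μ l : ℝ) / l / sqfreeHarmonic z else 0 := by
  have h1 : ∀ d ∈ (sqfreeUpTo z).filter (l ∣ ·), sieveWeight z d / d =
      ∑ e ∈ sqfreeUpTo z, if d ∣ e then (μ d : ℝ) * (1 / e) / sqfreeHarmonic z else 0 := by
    intro d hd
    have hd0 : (d : ℝ) ≠ 0 := by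
      have := (mem_sqfreeUpTo.1 (mem_filter.1 hd).1).1
      positivity
    rw [← sum_filter, ← sum_div, ← mul_sum, sieveWeight]
    field_simp
  rw [sum_congr rfl h1, sum_comm]
  have h2 : ∀ e ∈ sqfreeUpTo z, (∑ d ∈ (sqfreeUpTo z).filter (l ∣ ·),
      if d ∣ e then (μ d : ℝ) * (1 / e) / sqfreeHarmonic z else 0) =
      if l = e then (μ e : ℝ) / e / sqfreeHarmonic z else 0 := by
    intro e he
    rw [← sum_filter, filter_filter]
    have := sum_moebius_between (l := l) he
    calc _ = (∑ d ∈ (sqfreeUpTo z).filter (fun d ↦ l ∣ d ∧ d ∣ e), (μ d : ℝ)) *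
          (1 / e / sqfreeHarmonic z) := by
            rw [sum_mul]; exact sum_congr rfl fun _ _ ↦ by ring
      _ = _ := by rw [this]; split_ifs <;> ring
  rw [sum_congr rfl h2, sum_ite_eq]

lemma sieve_quadratic_form_le {z : ℕ} (hz : 1 ≤ z) :
    ∑ d ∈ sqfreeUpTo z, ∑ e ∈ sqfreeUpTo z,
      sieveWeight z d * sieveWeight z e / (d.lcm e : ℝ) ≤ 1 / sqfreeHarmonic z := by
  have hG := sqfreeHarmonic_pos hz
  have key : ∀ d ∈ sqfreeUpTo z, ∀ e ∈ sqfreeUpTo z,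
      sieveWeight z d * sieveWeight z e / (d.lcm e : ℝ) =
      ∑ l ∈ Icc 1 z, (Nat.totient l : ℝ) * ((if l ∣ d then sieveWeight z d / d else 0) *
        (if l ∣ e then sieveWeight z e / e else 0)) := by
    intro d hd e he
    obtain ⟨hd1, hdz, -⟩ := mem_sqfreeUpTo.1 hd
    obtain ⟨he1, -, -⟩ := mem_sqfreeUpTo.1 he
    have hg : 0 < d.gcd e := Nat.gcd_pos_of_pos_left _ hd1
    have h1 : ∀ l ∈ Icc 1 z, (Nat.totient l : ℝ) * ((if l ∣ d then sieveWeight z d / d else 0) *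
        (if l ∣ e then sieveWeight z e / e else 0)) =
        if l ∣ d.gcd e then
          (Nat.totient l : ℝ) * ((sieveWeight z d / d) * (sieveWeight z e / e)) else 0 := by
      intro l _
      by_cases h1 : l ∣ d <;> by_cases h2 : l ∣ e <;> simp [h1, h2, Nat.dvd_gcd_iff]
    rw [sum_congr rfl h1, ← sum_filter]
    have hset : (Icc 1 z).filter (· ∣ d.gcd e) = (d.gcd e).divisors := by
      ext l
      simp only [mem_filter, mem_Icc, Nat.mem_divisors]
      refine ⟨fun h ↦ ⟨h.2, hg.ne'⟩, fun h ↦ ⟨⟨Nat.pos_of_dvd_of_pos h.1 hg, ?_⟩, h.1⟩⟩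
      exact (Nat.le_of_dvd hd1 (h.1.trans (Nat.gcd_dvd_left _ _))).trans hdz
    rw [hset, ← sum_mul, ← Nat.cast_sum, Nat.sum_totient]
    have hprod : (d.gcd e : ℝ) * (d.lcm e : ℝ) = d * e := by exact_mod_cast Nat.gcd_mul_lcm d e
    have hl : (d.lcm e : ℝ) ≠ 0 := by
      have := Nat.lcm_pos hd1 he1
      positivity
    have hd0 : (d : ℝ) ≠ 0 := by positivity
    have he0 : (e : ℝ) ≠ 0 := by positivity
    field_simp
    linear_combination (-(sieveWeight z d * sieveWeight z e)) * hprod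
  rw [sum_congr rfl fun d hd ↦ sum_congr rfl (key d hd)]
  have swap : ∑ d ∈ sqfreeUpTo z, ∑ e ∈ sqfreeUpTo z, ∑ l ∈ Icc 1 z,
      (Nat.totient l : ℝ) * ((if l ∣ d then sieveWeight z d / d else 0) *
        (if l ∣ e then sieveWeight z e / e else 0)) =
      ∑ l ∈ Icc 1 z, (Nat.totient l : ℝ) *
        (∑ d ∈ (sqfreeUpTo z).filter (l ∣ ·), sieveWeight z d / d) ^ 2 := by
    simp_rw [sum_comm (t := Icc 1 z)]
    refine sum_congr rfl fun l _ ↦ ?_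
    rw [sum_filter, sq, sum_mul_sum, mul_sum]
    exact sum_congr rfl fun d _ ↦ by rw [mul_sum]
  rw [swap]
  calc _ ≤ ∑ l ∈ Icc 1 z, if Squarefree l then 1 / (l : ℝ) / sqfreeHarmonic z ^ 2 else 0 := by
        refine sum_le_sum fun l hl ↦ ?_
        rw [sum_sieveWeight_div]
        obtain ⟨hl1, hlz⟩ := mem_Icc.1 hl
        by_cases hs : Squarefree l
        · rw [if_pos (mem_sqfreeUpTo.2 ⟨hl1, hlz, hs⟩), if_pos hs]
          have hmu : (μ l : ℝ) ^ 2 = 1 := by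
            exact_mod_cast moebius_sq_eq_one_of_squarefree hs
          have hl0 : (0 : ℝ) < l := by positivity
          rw [div_pow, div_pow, hmu]
          have ht : (Nat.totient l : ℝ) ≤ l := by exact_mod_cast Nat.totient_le l
          calc _ ≤ (l : ℝ) * (1 / l ^ 2 / sqfreeHarmonic z ^ 2) := by gcongr
            _ = _ := by field_simp
        · rw [if_neg (fun h ↦ hs (mem_sqfreeUpTo.1 h).2.2), if_neg hs]
          simp
    _ = 1 / sqfreeHarmonic z := by
        rw [← sum_filter, ← sum_div, ← sqfreeUpTo, ← sqfreeHarmonic]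
        field_simp

lemma log_le_two_mul_sqfreeHarmonic (z : ℕ) : Real.log (z + 1) ≤ 2 * sqfreeHarmonic z := by
  have h1 : Real.log (z + 1) ≤ ∑ n ∈ Icc 1 z, (1 : ℝ) / n := by
    have := log_add_one_le_harmonic z
    rw [harmonic_eq_sum_Icc] at this
    push_cast at this
    simpa using this
  refine h1.trans ?_
  have h2 : ∑ n ∈ Icc 1 z, (1 : ℝ) / n ≤
      ∑ q ∈ Icc 1 z ×ˢ sqfreeUpTo z, (1 : ℝ) / (q.1 ^ 2 : ℕ) * (1 / q.2) := by
    have hdec : ∀ n ∈ Icc 1 z, ∃ q ∈ Icc 1 z ×ˢ sqfreeUpTo z, q.1 ^ 2 * q.2 = n := by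
      intro n hn
      obtain ⟨hn1, hnz⟩ := mem_Icc.1 hn
      obtain ⟨a, b, hab, ha⟩ := Nat.sq_mul_squarefree n
      have ha0 : 0 < a := Nat.pos_of_ne_zero fun h ↦ by simp [h] at hab; omega
      have hb0 : 0 < b := Nat.pos_of_ne_zero fun h ↦ by simp [h] at hab; omega
      refine ⟨(b, a), mem_product.2 ⟨mem_Icc.2 ⟨hb0, ?_⟩, mem_sqfreeUpTo.2 ⟨ha0, ?_, ha⟩⟩, hab⟩
      · show b ≤ z
        nlinarith
      · show a ≤ z
        nlinarith [Nat.pow_pos (n := 2) hb0]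
    choose! q hq hqn using hdec
    have hinj : Set.InjOn q (Icc 1 z : Finset ℕ) := by
      intro a ha b hb h
      rw [← hqn a ha, ← hqn b hb, h]
    calc ∑ n ∈ Icc 1 z, (1 : ℝ) / n
        = ∑ n ∈ Icc 1 z, (1 : ℝ) / ((q n).1 ^ 2 : ℕ) * (1 / (q n).2) := by
          refine sum_congr rfl fun n hn ↦ ?_
          conv_lhs => rw [← hqn n hn]
          push_cast
          rw [div_mul_div_comm, one_mul]
      _ = ∑ r ∈ (Icc 1 z).image q, (1 : ℝ) / (r.1 ^ 2 : ℕ) * (1 / r.2) := by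
          rw [sum_image hinj]
      _ ≤ _ := sum_le_sum_of_subset_of_nonneg
          (image_subset_iff.2 hq) fun _ _ _ ↦ by positivity
  refine h2.trans ?_
  rw [sum_product]
  dsimp only
  rw [← sum_mul_sum, ← sqfreeHarmonic]
  have h3 : ∑ n ∈ Icc 1 z, (1 : ℝ) / (n ^ 2 : ℕ) ≤ 2 := by
    have : ∀ z : ℕ, ∑ n ∈ Icc 1 z, (1 : ℝ) / (n ^ 2 : ℕ) ≤ 2 - 1 / (z + 1 / 2) := by
      intro z
      induction z with
      | zero => norm_num
      | succ k ih =>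
        rw [sum_Icc_succ_top (by omega)]
        have : (1 : ℝ) / ((k + 1) ^ 2 : ℕ) ≤ 1 / (k + 1 / 2) - 1 / (k + 1 + 1 / 2) := by
          push_cast
          have h : (1 : ℝ) / (k + 1 / 2) - 1 / (k + 1 + 1 / 2) = 1 / ((k + 1) ^ 2 - 1 / 4) := by
            have h1 : (k + 1 : ℝ) ^ 2 - 1 / 4 = (k + 1 / 2) * (k + 1 + 1 / 2) := by ring
            rw [h1, div_sub_div _ _ (by positivity) (by positivity)]
            ring
          rw [h]
          apply one_div_le_one_div_of_le <;> nlinarith [Nat.cast_nonneg (α := ℝ) k]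
        push_cast at this ih ⊢
        linarith
    have h4 : (0 : ℝ) ≤ 1 / (z + 1 / 2) := by positivity
    linarith [this z]
  gcongr
  exact sum_nonneg fun _ _ ↦ by positivity

lemma abs_card_multiples_sub_le (x y m : ℕ) (hm : 0 < m) :
    |(((Ioc x (x + y)).filter (m ∣ ·)).card : ℝ) - y / m| ≤ 1 := by
  have hsplit : ((Ioc x (x + y)).filter (m ∣ ·)).card + x / m = (x + y) / m := by
    rw [← Nat.Ioc_filter_dvd_card_eq_div x m, ← Nat.Ioc_filter_dvd_card_eq_div (x + y) m,
      ← card_union_of_disjoint]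
    · congr 1
      ext n
      simp only [mem_union, mem_filter, mem_Ioc]
      constructor
      · rintro (h | h) <;> exact ⟨by omega, h.2⟩
      · rintro ⟨h1, h2⟩
        by_cases hn : n ≤ x
        · exact Or.inr ⟨⟨h1.1, hn⟩, h2⟩
        · exact Or.inl ⟨⟨by omega, h1.2⟩, h2⟩
    · rw [disjoint_left]
      intro n h1 h2
      simp only [mem_filter, mem_Ioc] at h1 h2
      omega
  have hc : (((Ioc x (x + y)).filter (m ∣ ·)).card : ℝ) + ((x / m : ℕ) : ℝ) =
      (((x + y) / m : ℕ) : ℝ) := by exact_mod_cast hsplit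
  have hm' : (0 : ℝ) < m := by exact_mod_cast hm
  have bound : ∀ a : ℕ, ((a / m : ℕ) : ℝ) ≤ a / m ∧ (a : ℝ) / m - 1 ≤ ((a / m : ℕ) : ℝ) := by
    intro a
    refine ⟨Nat.cast_div_le, ?_⟩
    rw [sub_le_iff_le_add, div_le_iff₀ hm']
    have h1 := Nat.div_add_mod a m
    have h2 := Nat.mod_lt a hm
    have h3 : (m : ℝ) * ((a / m : ℕ) : ℝ) + ((a % m : ℕ) : ℝ) = a := by exact_mod_cast h1
    have h4 : ((a % m : ℕ) : ℝ) ≤ m := by exact_mod_cast h2.le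
    nlinarith
  obtain ⟨h1, h2⟩ := bound x
  obtain ⟨h3, h4⟩ := bound (x + y)
  have h5 : ((x + y : ℕ) : ℝ) / m = x / m + y / m := by push_cast; ring
  rw [abs_le]
  constructor <;> linarith

lemma card_primes_gt_le {z : ℕ} (hz : 1 ≤ z) (x y : ℕ) :
    (((Ioc x (x + y)).filter (fun n ↦ n.Prime ∧ z < n)).card : ℝ) ≤
      y / sqfreeHarmonic z + z ^ 4 := by
  set S := sqfreeUpTo z with hS
  set w := sieveWeight z with hw
  set I := Ioc x (x + y) with hI
  have h1 : ((I.filter (fun n ↦ n.Prime ∧ z < n)).card : ℝ) ≤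
      ∑ n ∈ I, (∑ d ∈ S, if d ∣ n then w d else 0) ^ 2 := by
    rw [card_eq_sum_ones, Nat.cast_sum, sum_filter]
    refine sum_le_sum fun n _ ↦ ?_
    split_ifs with hn
    · have h2 : (∑ d ∈ S, if d ∣ n then w d else 0) = 1 := by
        rw [sum_eq_single 1]
        · simp [hw, sieveWeight_one hz]
        · intro d hd hd1
          rw [if_neg]
          intro hdn
          rcases (Nat.dvd_prime hn.1).1 hdn with h | h
          · exact hd1 h
          · have := (mem_sqfreeUpTo.1 hd).2.1
            omega
        · intro h
          exact absurd (mem_sqfreeUpTo.2 ⟨le_rfl, hz, squarefree_one⟩) h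
      rw [h2]
      simp
    · positivity
  refine h1.trans ?_
  have h2 : ∑ n ∈ I, (∑ d ∈ S, if d ∣ n then w d else 0) ^ 2 =
      ∑ d ∈ S, ∑ e ∈ S, w d * w e * ((I.filter (d.lcm e ∣ ·)).card : ℝ) := by
    have : ∀ n ∈ I, (∑ d ∈ S, if d ∣ n then w d else 0) ^ 2 =
        ∑ d ∈ S, ∑ e ∈ S, if d.lcm e ∣ n then w d * w e else 0 := by
      intro n _
      rw [sq, sum_mul_sum]
      refine sum_congr rfl fun d _ ↦ sum_congr rfl fun e _ ↦ ?_
      by_cases h1 : d ∣ n <;> by_cases h2 : e ∣ n <;> simp [h1, h2, Nat.lcm_dvd_iff]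
    rw [sum_congr rfl this, sum_comm]
    refine sum_congr rfl fun d _ ↦ ?_
    rw [sum_comm]
    refine sum_congr rfl fun e _ ↦ ?_
    rw [← sum_filter, sum_const, nsmul_eq_mul, mul_comm]
  rw [h2]
  have h3 : ∀ d ∈ S, ∀ e ∈ S, w d * w e * ((I.filter (d.lcm e ∣ ·)).card : ℝ) ≤
      y * (w d * w e / (d.lcm e : ℝ)) + z ^ 2 := by
    intro d hd e he
    obtain ⟨hd1, hdz, -⟩ := mem_sqfreeUpTo.1 hd
    obtain ⟨he1, hez, -⟩ := mem_sqfreeUpTo.1 he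
    have hdiff := abs_card_multiples_sub_le x y (d.lcm e) (Nat.lcm_pos hd1 he1)
    have hww : |w d * w e| ≤ z ^ 2 := by
      rw [abs_mul, sq]
      exact mul_le_mul (abs_sieveWeight_le hz hdz) (abs_sieveWeight_le hz hez) (abs_nonneg _)
        (by positivity)
    have := abs_mul (w d * w e) (((I.filter (d.lcm e ∣ ·)).card : ℝ) - y / (d.lcm e : ℝ))
    have h5 : |w d * w e| * |((I.filter (d.lcm e ∣ ·)).card : ℝ) - y / (d.lcm e : ℝ)| ≤
        z ^ 2 * 1 := mul_le_mul hww hdiff (abs_nonneg _) (by positivity)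
    have h6 := le_abs_self
      ((w d * w e) * (((I.filter (d.lcm e ∣ ·)).card : ℝ) - y / (d.lcm e : ℝ)))
    have h7 : (w d * w e) * (((I.filter (d.lcm e ∣ ·)).card : ℝ) - y / (d.lcm e : ℝ)) =
      w d * w e * ((I.filter (d.lcm e ∣ ·)).card : ℝ) - y * (w d * w e / (d.lcm e : ℝ)) := by ring
    linarith
  have hcard : (S.card : ℝ) ≤ z := by
    have : S.card ≤ (Icc 1 z).card := card_le_card (filter_subset _ _)
    rw [Nat.card_Icc] at this
    exact_mod_cast (by omega : S.card ≤ z)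
  calc _ ≤ ∑ d ∈ S, ∑ e ∈ S, (y * (w d * w e / (d.lcm e : ℝ)) + (z : ℝ) ^ 2) :=
        sum_le_sum fun d hd ↦ sum_le_sum fun e he ↦ h3 d hd e he
    _ = y * (∑ d ∈ S, ∑ e ∈ S, w d * w e / (d.lcm e : ℝ)) + S.card * (S.card * (z : ℝ) ^ 2) := by
        simp only [sum_add_distrib, sum_const, nsmul_eq_mul, mul_sum]
    _ ≤ y * (1 / sqfreeHarmonic z) + z * (z * (z : ℝ) ^ 2) := by
        gcongr
        exact sieve_quadratic_form_le hz
    _ = _ := by ring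

/-- A weak form of the Brun–Titchmarsh inequality. -/
theorem card_primes_Ioc_le (x y : ℕ) (hy : 2 ≤ y) :
    (((Ioc x (x + y)).filter Nat.Prime).card : ℝ) ≤ 20 * y / Real.log y := by
  have hy2 : (2 : ℝ) ≤ y := by exact_mod_cast hy
  have hlog : 0 < Real.log y := Real.log_pos (by linarith)
  set z : ℕ := ⌊(y : ℝ) ^ (1 / 8 : ℝ)⌋₊ with hzdef
  have hy8 : (1 : ℝ) ≤ (y : ℝ) ^ (1 / 8 : ℝ) := Real.one_le_rpow (by linarith) (by norm_num)
  have hz : 1 ≤ z := by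
    rw [hzdef, Nat.one_le_floor_iff]
    exact hy8
  have hz1 : (1 : ℝ) ≤ z := by exact_mod_cast hz
  have hz4 : (z : ℝ) ^ 4 ≤ √y := by
    have h : (z : ℝ) ≤ (y : ℝ) ^ (1 / 8 : ℝ) := Nat.floor_le (by linarith)
    calc (z : ℝ) ^ 4 ≤ ((y : ℝ) ^ (1 / 8 : ℝ)) ^ 4 := by gcongr
      _ = √y := by
        rw [← Real.rpow_natCast, ← Real.rpow_mul (by linarith), Real.sqrt_eq_rpow]
        norm_num
  have hzz : (z : ℝ) ≤ z ^ 4 := le_self_pow₀ hz1 (by norm_num)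
  have hG : Real.log y / 16 ≤ sqfreeHarmonic z := by
    have h1 := log_le_two_mul_sqfreeHarmonic z
    have h2 : Real.log ((y : ℝ) ^ (1 / 8 : ℝ)) ≤ Real.log (z + 1) :=
      Real.log_le_log (by linarith) (Nat.lt_floor_add_one _).le
    rw [Real.log_rpow (by linarith)] at h2
    linarith
  have hsq : √y ≤ 2 * y / Real.log y := by
    rw [le_div_iff₀ hlog]
    have h1 : Real.log y = 2 * Real.log √y := by rw [Real.log_sqrt (by linarith)]; ring
    have h2 : Real.log √y ≤ √y := Real.log_le_self (Real.sqrt_nonneg _)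
    have h3 : √(y : ℝ) * √y = y := Real.mul_self_sqrt (by linarith)
    rw [h1]
    nlinarith [Real.sqrt_nonneg (y : ℝ)]
  have hsub : (Ioc x (x + y)).filter Nat.Prime ⊆
      (Ioc x (x + y)).filter (fun n ↦ n.Prime ∧ z < n) ∪ Icc 1 z := by
    intro p hp
    simp only [mem_filter, mem_union, mem_Icc] at hp ⊢
    have := hp.2.pos
    by_cases h : z < p
    · exact Or.inl ⟨hp.1, hp.2, h⟩
    · exact Or.inr ⟨by omega, by omega⟩
  have hcard : (((Ioc x (x + y)).filter Nat.Prime).card : ℝ) ≤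
      ((Ioc x (x + y)).filter (fun n ↦ n.Prime ∧ z < n)).card + z := by
    have h1 := (card_le_card hsub).trans (card_union_le _ _)
    rw [Nat.card_Icc, Nat.add_sub_cancel] at h1
    exact_mod_cast h1
  have hmain := card_primes_gt_le hz x y
  have hyG : (y : ℝ) / sqfreeHarmonic z ≤ 16 * y / Real.log y := by
    calc (y : ℝ) / sqfreeHarmonic z ≤ y / (Real.log y / 16) := by gcongr
      _ = _ := by field_simp
  have : 20 * (y : ℝ) / Real.log y = 16 * y / Real.log y + 2 * (2 * y / Real.log y) := by ring
  linarith

end Sieve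

/-! ### Reciprocals of primes in a short multiplicative window -/

section Window

open Finset

lemma sum_le_sum_filter_of_cover {α ι : Type*} (S : Finset α) (I : Finset ι)
    (P : ι → α → Prop) [∀ i, DecidablePred (P i)] (f : α → ℝ) (hf : ∀ a, 0 ≤ f a) (hP : ∀ a ∈ S, ∃ i ∈ I, P i a) :
    ∑ a ∈ S, f a ≤ ∑ i ∈ I, ∑ a ∈ S.filter (P i), f a := by
  simp_rw [sum_filter]
  rw [sum_comm]
  refine sum_le_sum fun a ha ↦ ?_
  obtain ⟨i, hi, hPi⟩ := hP a ha
  calc f a = if P i a then f a else 0 := (if_pos hPi).symm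
    _ ≤ _ := single_le_sum (f := fun i ↦ if P i a then f a else 0)
      (fun j _ ↦ by split_ifs <;> simp [hf]) hi

lemma sum_inv_primes_window_of_le_one {L : ℕ} (hL : 2 ≤ L) {V η : ℝ} (hη : 0 < η)
    (hη1 : η ≤ 1) (S : Finset ℕ)
    (hS : ∀ p ∈ S, p.Prime ∧ L < p ∧ V ≤ p ∧ (p : ℝ) ≤ V * Real.exp (2 * η)) :
    ∑ p ∈ S, (1 : ℝ) / p ≤ 1280 * η / Real.log L + 2 / √L := by
  have hL2 : (2 : ℝ) ≤ L := by exact_mod_cast hL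
  have hlogL : 0 < Real.log L := Real.log_pos (by linarith)
  set U : ℝ := max V L with hU
  have hUL : (L : ℝ) ≤ U := le_max_right _ _
  have hUpos : 0 < U := by linarith
  have hsqU : 1 ≤ √U := Real.one_le_sqrt.2 (by linarith)
  have hsqmul : √U * √U = U := Real.mul_self_sqrt hUpos.le
  set Y : ℝ := U * (Real.exp (2 * η) - 1) with hY
  have hexp : 0 < Real.exp (2 * η) - 1 := by
    have := Real.add_one_lt_exp (x := 2 * η) (by positivity)
    linarith
  have hexp' : Real.exp (2 * η) - 1 ≤ 16 * η := by
    have h1 : 1 - 2 * η ≤ Real.exp (-(2 * η)) := by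
      have := Real.add_one_le_exp (-(2 * η)); linarith
    have h2 : Real.exp (-(2 * η)) * Real.exp (2 * η) = 1 := by
      rw [← Real.exp_add]; simp
    have h3 : Real.exp (2 * η) ≤ 8 := by
      calc Real.exp (2 * η) ≤ Real.exp 2 := Real.exp_le_exp.2 (by linarith)
        _ = Real.exp 1 * Real.exp 1 := by rw [← Real.exp_add]; norm_num
        _ ≤ 2.8 * 2.8 := by
          have := Real.exp_one_lt_d9
          have := Real.exp_pos 1
          gcongr <;> linarith
        _ ≤ 8 := by norm_num
    nlinarith [Real.exp_pos (2 * η)]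
  have hYpos : 0 < Y := mul_pos hUpos hexp
  set x : ℕ := ⌈U⌉₊ - 1 with hx
  set y : ℕ := ⌊Y⌋₊ + 1 with hy
  have hceil : 1 ≤ ⌈U⌉₊ := Nat.one_le_ceil_iff.2 hUpos
  have hyY : Y < y := by rw [hy]; push_cast; exact Nat.lt_floor_add_one Y
  have hyY' : (y : ℝ) ≤ Y + 1 := by
    rw [hy]; push_cast; linarith [Nat.floor_le hYpos.le]
  have hUp : ∀ p ∈ S, U ≤ p := fun p hp ↦
    max_le (hS p hp).2.2.1 (by exact_mod_cast (hS p hp).2.1.le)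
  have hsub : S ⊆ (Ioc x (x + y)).filter Nat.Prime := by
    intro p hp
    obtain ⟨hpp, -, -, hp2⟩ := hS p hp
    have hc : ⌈U⌉₊ ≤ p := Nat.ceil_le.2 (hUp p hp)
    have hx1 : U ≤ x + 1 := by
      have : (x : ℝ) + 1 = (⌈U⌉₊ : ℝ) := by exact_mod_cast (by omega : x + 1 = ⌈U⌉₊)
      rw [this]; exact Nat.le_ceil U
    have hp3 : (p : ℝ) ≤ U + Y := by
      calc (p : ℝ) ≤ V * Real.exp (2 * η) := hp2
        _ ≤ U * Real.exp (2 * η) := by gcongr; exact le_max_left _ _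
        _ = U + Y := by rw [hY]; ring
    have hp4 : (p : ℝ) < ((x + y + 1 : ℕ) : ℝ) := by push_cast; linarith
    have hp5 : p < x + y + 1 := by exact_mod_cast hp4
    simp only [mem_filter, mem_Ioc]
    exact ⟨by omega, hpp⟩
  have hsum : ∑ p ∈ S, (1 : ℝ) / p ≤ S.card / U := by
    calc _ ≤ ∑ p ∈ S, 1 / U := sum_le_sum fun p hp ↦ one_div_le_one_div_of_le hUpos (hUp p hp)
      _ = _ := by rw [sum_const, nsmul_eq_mul, mul_one_div]
  refine hsum.trans ?_
  by_cases hcase : √U ≤ Y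
  · have hy2 : 2 ≤ y := by
      have : 1 ≤ ⌊Y⌋₊ := (Nat.one_le_floor_iff Y).2 (hsqU.trans hcase)
      omega
    have hcard : (S.card : ℝ) ≤ 20 * y / Real.log y :=
      le_trans (by exact_mod_cast card_le_card hsub) (card_primes_Ioc_le x y hy2)
    have hlogy : Real.log L / 2 ≤ Real.log y := by
      calc Real.log L / 2 ≤ Real.log U / 2 := by
            gcongr
        _ = Real.log √U := by rw [Real.log_sqrt hUpos.le]
        _ ≤ Real.log y := Real.log_le_log (by linarith) (by linarith)
    have h1 : (S.card : ℝ) ≤ 80 * Y / Real.log L := by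
      calc (S.card : ℝ) ≤ 20 * y / Real.log y := hcard
        _ ≤ 20 * (2 * Y) / (Real.log L / 2) := by gcongr; linarith
        _ = _ := by field_simp; ring
    calc (S.card : ℝ) / U ≤ 80 * Y / Real.log L / U := by gcongr
      _ = 80 * (Real.exp (2 * η) - 1) / Real.log L := by rw [hY]; field_simp
      _ ≤ 80 * (16 * η) / Real.log L := by gcongr
      _ = 1280 * η / Real.log L := by ring
      _ ≤ _ := le_add_of_nonneg_right (by positivity)
  · have hcard : (S.card : ℝ) ≤ 2 * √U := by
      have h1 : S.card ≤ y := by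
        have := card_le_card (hsub.trans (filter_subset _ _))
        rwa [Nat.card_Ioc, Nat.add_sub_cancel_left] at this
      have h2 : (S.card : ℝ) ≤ y := by exact_mod_cast h1
      linarith
    calc (S.card : ℝ) / U ≤ 2 * √U / U := by gcongr
      _ = 2 / √U := by rw [div_eq_div_iff hUpos.ne' (by positivity)]; linear_combination 2 * hsqmul
      _ ≤ 2 / √L := by gcongr
      _ ≤ _ := le_add_of_nonneg_left (by positivity)

lemma sum_inv_primes_window {L : ℕ} (hL : 2 ≤ L) {V η : ℝ} (hη : 0 < η) (S : Finset ℕ)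
    (hS : ∀ p ∈ S, p.Prime ∧ L < p ∧ V ≤ p ∧ (p : ℝ) ≤ V * Real.exp (2 * η)) :
    ∑ p ∈ S, (1 : ℝ) / p ≤ 2000 * η / Real.log L + if η < 1 then 2 / √L else 0 := by
  have hL2 : (2 : ℝ) ≤ L := by exact_mod_cast hL
  have hlogL : 0 < Real.log L := Real.log_pos (by linarith)
  split_ifs with h1
  · refine (sum_inv_primes_window_of_le_one hL hη h1.le S hS).trans ?_
    gcongr
    norm_num
  push Not at h1
  rcases S.eq_empty_or_nonempty with rfl | ⟨p₀, hp₀⟩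
  · simp; positivity
  have hV : 0 < V := by
    have h := (hS p₀ hp₀).2.2.2
    have : (0 : ℝ) < p₀ := by exact_mod_cast (hS p₀ hp₀).1.pos
    exact pos_of_mul_pos_left (this.trans_le h) (Real.exp_pos _).le
  set N : ℕ := ⌊2 * η⌋₊ + 1 with hN
  let P : ℕ → ℕ → Prop := fun i p ↦
    V * Real.exp i ≤ p ∧ (p : ℝ) ≤ V * Real.exp i * Real.exp (2 * (1 / 2))
  have hcover : ∀ p ∈ S, ∃ i ∈ range N, P i p := by
    intro p hp
    obtain ⟨hpp, -, hVp, hp2⟩ := hS p hp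
    have hp0 : (0 : ℝ) < p := by exact_mod_cast hpp.pos
    set t := Real.log (p / V) with ht
    have hpt : (p : ℝ) = V * Real.exp t := by
      rw [ht, Real.exp_log (by positivity)]; field_simp
    have ht0 : 0 ≤ t := Real.log_nonneg (by rw [le_div_iff₀ hV]; linarith)
    have ht1 : t ≤ 2 * η := by
      rw [hpt] at hp2
      exact Real.exp_le_exp.1 (le_of_mul_le_mul_left hp2 hV)
    refine ⟨⌊t⌋₊, mem_range.2 ?_, ?_, ?_⟩
    · have := Nat.floor_le_floor ht1
      omega
    · rw [hpt]
      gcongr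
      exact Nat.floor_le ht0
    · rw [hpt, mul_assoc, ← Real.exp_add]
      gcongr
      have := (Nat.lt_floor_add_one t).le
      linarith
  have hpart : ∀ i ∈ range N, ∑ p ∈ S.filter (P i), (1 : ℝ) / p ≤ 644 / Real.log L := by
    intro i _
    have h2 := sum_inv_primes_window_of_le_one hL (V := V * Real.exp i) (η := 1 / 2)
      (by norm_num) (by norm_num) (S.filter (P i)) fun p hp ↦
        ⟨(hS p (mem_filter.1 hp).1).1, (hS p (mem_filter.1 hp).1).2.1, (mem_filter.1 hp).2⟩
    have h3 : 2 / √(L : ℝ) ≤ 4 / Real.log L := by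
      rw [div_le_div_iff₀ (by positivity) hlogL]
      have : Real.log √L ≤ √L := Real.log_le_self (Real.sqrt_nonneg _)
      rw [Real.log_sqrt (by linarith)] at this
      linarith
    calc _ ≤ _ := h2
      _ ≤ 1280 * (1 / 2) / Real.log L + 4 / Real.log L := by gcongr
      _ = _ := by ring
  calc ∑ p ∈ S, (1 : ℝ) / p ≤ ∑ i ∈ range N, ∑ p ∈ S.filter (P i), (1 : ℝ) / p :=
        sum_le_sum_filter_of_cover S (range N) P (fun p ↦ (1 : ℝ) / p) (fun p ↦ by positivity) hcover
    _ ≤ ∑ i ∈ range N, 644 / Real.log L := sum_le_sum hpart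
    _ = N * (644 / Real.log L) := by rw [sum_const, card_range, nsmul_eq_mul]
    _ ≤ (3 * η) * (644 / Real.log L) := by
        gcongr
        rw [hN]; push_cast
        linarith [Nat.floor_le (show 0 ≤ 2 * η by positivity)]
    _ = 1932 * η / Real.log L := by ring
    _ ≤ 2000 * η / Real.log L + 0 := by rw [add_zero]; gcongr; norm_num

end Window

/-! ### Roots of integer polynomials modulo integers -/

section RootCount

open Finset Polynomial

lemma polyRho_eq_card_filter_range (F : ℤ[X]) (d : ℕ) :
    polyRho F d = ((range d).filter fun n : ℕ ↦ (d : ℤ) ∣ F.eval (n : ℤ)).card := by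
  have : (do let a ← range d; pure (a : ℤ) : Finset ℤ) = (range d).image Nat.cast := by
    ext; simp [eq_comm]
  rw [polyRho, this, filter_image, card_image_of_injective _ Nat.cast_injective]

lemma polyRho_one (F : ℤ[X]) : polyRho F 1 = 1 := by
  simp [polyRho_eq_card_filter_range]

lemma polyRho_mul_le (F : ℤ[X]) {a b : ℕ} (ha : a ≠ 0) (hb : b ≠ 0) (hab : a.Coprime b) :
    polyRho F (a * b) ≤ polyRho F a * polyRho F b := by
  have hmod : ∀ {c n : ℕ}, (c : ℤ) ∣ F.eval (n : ℤ) → (c : ℤ) ∣ F.eval ((n % c : ℕ) : ℤ) := by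
    intro c n h
    have h1 : (c : ℤ) ∣ (n : ℤ) - (n % c : ℕ) := by
      rw [Int.natCast_mod]; exact Int.dvd_self_sub_emod
    exact (dvd_iff_dvd_of_dvd_sub (h1.trans (F.sub_dvd_eval_sub _ _))).1 h
  simp only [polyRho_eq_card_filter_range]
  rw [← card_product]
  refine card_le_card_of_injOn (fun n ↦ (n % a, n % b)) ?_ ?_
  · intro n hn
    rw [mem_coe, mem_filter, mem_range] at hn
    have hdvd := hn.2
    push_cast at hdvd
    simp only [coe_product, Set.mem_prod, mem_coe, mem_filter, mem_range]
    exact ⟨⟨Nat.mod_lt _ (Nat.pos_of_ne_zero ha), hmod ((Dvd.intro _ rfl).trans hdvd)⟩,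
      Nat.mod_lt _ (Nat.pos_of_ne_zero hb), hmod ((Dvd.intro_left _ rfl).trans hdvd)⟩
  · intro n hn n' hn' h
    rw [mem_coe, mem_filter, mem_range] at hn hn'
    simp only [Prod.mk.injEq] at h
    have := (Nat.modEq_and_modEq_iff_modEq_mul hab).1 ⟨h.1, h.2⟩
    exact this.eq_of_lt_of_lt hn.1 hn'.1

lemma eval_natCast_map_zmod_eq_zero_iff (F : ℤ[X]) (p n : ℕ) :
    (F.map (Int.castRingHom (ZMod p))).eval (n : ZMod p) = 0 ↔ (p : ℤ) ∣ F.eval (n : ℤ) := by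
  rw [eval_map, ← Int.cast_natCast n, ← eq_intCast (Int.castRingHom (ZMod p)), eval₂_at_apply,
    eq_intCast, ZMod.intCast_zmod_eq_zero_iff_dvd]

lemma polyRho_prime_le_natDegree {F : ℤ[X]} (hF : F.IsPrimitive) {p : ℕ} (hp : p.Prime) :
    polyRho F p ≤ F.natDegree := by
  have := Fact.mk hp
  have hne : F.map (Int.castRingHom (ZMod p)) ≠ 0 := by
    intro h
    have hdvd : C (p : ℤ) ∣ F := by
      rw [C_dvd_iff_dvd_coeff]
      intro i
      have := congrArg (fun G ↦ coeff G i) h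
      simpa [coeff_map, ZMod.intCast_zmod_eq_zero_iff_dvd] using this
    have hu := hF _ hdvd
    rw [Int.isUnit_iff] at hu
    have := hp.two_le
    omega
  calc polyRho F p ≤ (F.map (Int.castRingHom (ZMod p))).roots.toFinset.card := by
        rw [polyRho_eq_card_filter_range]
        refine card_le_card_of_injOn (fun n ↦ (n : ZMod p)) ?_ ?_
        · intro n hn
          rw [mem_coe, mem_filter] at hn
          rw [mem_coe, Multiset.mem_toFinset, mem_roots hne, IsRoot.def]
          exact (eval_natCast_map_zmod_eq_zero_iff F p n).2 hn.2
        · intro n hn n' hn' h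
          rw [mem_coe, mem_filter, mem_range] at hn hn'
          exact ((ZMod.natCast_eq_natCast_iff _ _ _).1 h).eq_of_lt_of_lt hn.1 hn'.1
    _ ≤ (F.map (Int.castRingHom (ZMod p))).natDegree :=
        (Multiset.toFinset_card_le _).trans (card_roots' _)
    _ ≤ F.natDegree := natDegree_map_le

end RootCount

/-! ### Roots modulo a prime and prime ideals of prime norm -/

section NumberField

open Finset Polynomial NumberField Ideal RingOfIntegers

variable {K : Type*} [Field K] [NumberField K]

lemma exponent_ne_zero_of_adjoin_eq_top {θ : 𝓞 K} (hθ : Algebra.adjoin ℚ {(θ : K)} = ⊤) :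
    exponent θ ≠ 0 := by
  let B := PowerBasis.ofAdjoinEqTop (Algebra.IsIntegral.isIntegral (R := ℚ) (θ : K)) hθ
  have hB : B.gen = (θ : K) := by simp [B]
  have hint : IsIntegral ℤ B.gen := hB ▸ θ.isIntegral_coe
  have hd : IsIntegral ℤ (Algebra.discr ℚ B.basis) := by
    apply Algebra.discr_isIntegral
    intro i
    rw [B.basis_eq_pow]
    exact hint.pow _
  obtain ⟨d, hd⟩ := IsIntegrallyClosed.isIntegral_iff.1 hd
  have hd0 : d ≠ 0 := by
    rintro rfl
    exact Algebra.discr_not_zero_of_basis ℚ B.basis (by rw [← hd, map_zero])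
  have hmem : (d.natAbs : 𝓞 K) ∈ conductor ℤ θ := by
    have : ((d : ℤ) : 𝓞 K) ∈ conductor ℤ θ := by
      rw [mem_conductor_iff]
      intro b
      have h := Algebra.discr_mul_isIntegral_mem_adjoin (R := ℤ) ℚ hint b.isIntegral_coe
      rw [← hd, hB] at h
      have h2 : (algebraMap ℤ ℚ d) • (b : K) = algebraMap (𝓞 K) K ((d : 𝓞 K) * b) := by
        simp [Algebra.smul_def]
      rw [h2] at h
      have h3 : Algebra.adjoin ℤ {(θ : K)} = (Algebra.adjoin ℤ {θ}).map
          (IsScalarTower.toAlgHom ℤ (𝓞 K) K) := by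
        rw [AlgHom.map_adjoin]; simp
      rw [h3] at h
      obtain ⟨y, hy, hyb⟩ := h
      rwa [← RingOfIntegers.coe_injective hyb]
    rcases Int.natAbs_eq d with h | h
    · rwa [h, Int.cast_natCast] at this
    · rwa [h, Int.cast_neg, neg_mem_iff, Int.cast_natCast] at this
  rw [exponent_eq_sInf]
  intro h0
  rw [Nat.sInf_eq_zero] at h0
  rcases h0 with h0 | h0
  · exact absurd h0.1 (lt_irrefl _)
  · exact Set.notMem_empty d.natAbs (h0 ▸ ⟨Int.natAbs_pos.2 hd0, hmem⟩)

lemma exists_primes_absNorm_eq_of_roots {θ : 𝓞 K} {p : ℕ} (hp : p.Prime) (hpθ : ¬ p ∣ exponent θ)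
    (S : Finset (ZMod p)) (hS : ∀ r ∈ S, ((minpoly ℤ θ).map (Int.castRingHom (ZMod p))).eval r = 0) :
    ∃ Q : Finset (Ideal (𝓞 K)), Q.card = S.card ∧ ∀ P ∈ Q, P.IsPrime ∧ absNorm P = p := by
  have := Fact.mk hp
  have hne : (minpoly ℤ θ).map (Int.castRingHom (ZMod p)) ≠ 0 :=
    map_monic_ne_zero (minpoly.monic θ.isIntegral)
  have hmem : ∀ r ∈ S, (X - C r : (ZMod p)[X]) ∈ monicFactorsMod θ p := by
    intro r hr
    rw [Multiset.mem_toFinset, Polynomial.mem_normalizedFactors_iff hne]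
    exact ⟨irreducible_X_sub_C r, monic_X_sub_C r, dvd_iff_isRoot.2 (hS r hr)⟩
  let f : S → Ideal (𝓞 K) := fun r ↦
    (NumberField.Ideal.primesOverSpanEquivMonicFactorsMod hpθ).symm ⟨X - C r.1, hmem r.1 r.2⟩
  have hf : Function.Injective f := by
    intro r r' h
    have := (NumberField.Ideal.primesOverSpanEquivMonicFactorsMod hpθ).symm.injective
      (Subtype.ext h)
    exact Subtype.ext (C_injective (sub_right_injective (congrArg Subtype.val this)))
  refine ⟨univ.image f, by rw [card_image_of_injective _ hf]; simp, ?_⟩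
  intro P hP
  obtain ⟨r, -, rfl⟩ := mem_image.1 hP
  have hmemP := ((NumberField.Ideal.primesOverSpanEquivMonicFactorsMod hpθ).symm
    ⟨X - C r.1, hmem r.1 r.2⟩).2
  have := hmemP.1
  have := hmemP.2
  refine ⟨hmemP.1, ?_⟩
  rw [← Ideal.pow_inertiaDeg p,
    NumberField.Ideal.inertiaDeg_primesOverSpanEquivMonicFactorsMod_symm_apply' hpθ,
    natDegree_X_sub_C, pow_one]

lemma exists_primes_absNorm_eq_of_aeval_eq_zero {F : ℤ[X]} (hdeg : 1 ≤ F.natDegree) {r : K}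
    (hr : aeval r F = 0) (htop : Algebra.adjoin ℚ {r} = ⊤)
    (hfinrank : Module.finrank ℚ K = F.natDegree) :
    ∃ B : ℕ, B ≠ 0 ∧ ∀ p : ℕ, p.Prime → ¬ p ∣ B →
      ∃ Q : Finset (Ideal (𝓞 K)), Q.card = polyRho F p ∧ ∀ P ∈ Q, P.IsPrime ∧ absNorm P = p := by
  have hF0 : F ≠ 0 := by rintro rfl; simp at hdeg
  set l := F.leadingCoeff with hl
  have hl0 : l ≠ 0 := leadingCoeff_ne_zero.2 hF0
  set G := integralNormalization F with hG
  have hGm : G.Monic := monic_integralNormalization hF0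
  have hGr : aeval ((l : K) * r) G = 0 := by
    simpa using integralNormalization_aeval_eq_zero (A := K) hr (by simp)
  obtain ⟨θ, hθ⟩ : ∃ θ : 𝓞 K, (θ : K) = (l : K) * r := ⟨⟨_, G, hGm, hGr⟩, rfl⟩
  have hadj : Algebra.adjoin ℚ {(θ : K)} = ⊤ := by
    rw [eq_top_iff, ← htop, Algebra.adjoin_le_iff, Set.singleton_subset_iff]
    have h1 : r = (l : ℚ)⁻¹ • (θ : K) := by
      have : (l : K) ≠ 0 := by exact_mod_cast hl0
      simp [hθ, Algebra.smul_def, this]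
    rw [SetLike.mem_coe, h1]
    exact Subalgebra.smul_mem _ (Algebra.self_mem_adjoin_singleton _ _) _
  have hθr : aeval (θ : K) G = 0 := by rw [hθ, hGr]
  have hmin : minpoly ℤ θ = G := by
    have h1 : minpoly ℤ θ = minpoly ℤ (θ : K) :=
      (minpoly.algebraMap_eq RingOfIntegers.coe_injective θ).symm
    have h2 : (minpoly ℤ (θ : K)).natDegree = F.natDegree := by
      let B := PowerBasis.ofAdjoinEqTop (Algebra.IsIntegral.isIntegral (R := ℚ) (θ : K)) hadj
      have hB : B.gen = (θ : K) := by simp [B]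
      have h3 := minpoly.isIntegrallyClosed_eq_field_fractions' ℚ θ.isIntegral_coe
      rw [← hfinrank, B.finrank, ← B.natDegree_minpoly, hB, h3,
        (minpoly.monic θ.isIntegral_coe).natDegree_map]
    rw [h1]
    refine (eq_of_monic_of_dvd_of_natDegree_le (minpoly.monic θ.isIntegral_coe) hGm
      (minpoly.isIntegrallyClosed_dvd θ.isIntegral_coe hθr) ?_).symm
    rw [h2, natDegree_eq_of_degree_eq degree_integralNormalization]
  refine ⟨l.natAbs * exponent θ,
    mul_ne_zero (Int.natAbs_ne_zero.2 hl0) (exponent_ne_zero_of_adjoin_eq_top hadj), ?_⟩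
  intro p hp hpB
  have := Fact.mk hp
  have hlp : (l : ZMod p) ≠ 0 := by
    rw [Ne, ZMod.intCast_zmod_eq_zero_iff_dvd, Int.natCast_dvd]
    exact fun h ↦ hpB (h.mul_right _)
  obtain ⟨Q, hQ, hQ'⟩ := exists_primes_absNorm_eq_of_roots hp
    (fun h ↦ hpB (h.mul_left _))
    (((Finset.range p).filter fun n : ℕ ↦ (p : ℤ) ∣ F.eval (n : ℤ)).image
      fun n : ℕ ↦ (l : ZMod p) * n) (fun s hs ↦ by
    obtain ⟨n, hn, rfl⟩ := mem_image.1 hs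
    have h := integralNormalization_eval₂_leadingCoeff_mul hdeg (Int.castRingHom (ZMod p))
      (n : ZMod p)
    rw [← eval_map (p := F), (eval_natCast_map_zmod_eq_zero_iff F p n).2 (mem_filter.1 hn).2,
      mul_zero] at h
    rw [hmin, eval_map]
    exact h)
  refine ⟨Q, ?_, hQ'⟩
  rw [hQ, polyRho_eq_card_filter_range]
  refine card_image_of_injOn ?_
  intro n hn n' hn' h
  rw [mem_coe, mem_filter, mem_range] at hn hn'
  exact ((ZMod.natCast_eq_natCast_iff _ _ _).1 (mul_left_cancel₀ hlp h)).eq_of_lt_of_lt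
    hn.1 hn'.1

lemma exists_numberField_primes_absNorm_eq {F : ℤ[X]} (hF : Irreducible F)
    (hdeg : 1 ≤ F.natDegree) :
    ∃ (K : Type) (_ : Field K) (_ : NumberField K) (B : ℕ), B ≠ 0 ∧ ∀ p : ℕ, p.Prime → ¬ p ∣ B →
      ∃ Q : Finset (Ideal (𝓞 K)), Q.card = polyRho F p ∧ ∀ P ∈ Q, P.IsPrime ∧ absNorm P = p := by
  have hirr : Irreducible (F.map (Int.castRingHom ℚ)) :=
    (IsPrimitive.Int.irreducible_iff_irreducible_map_cast (hF.isPrimitive (by omega))).1 hF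
  have := Fact.mk hirr
  have := (AdjoinRoot.powerBasis hirr.ne_zero).finite
  have : NumberField (AdjoinRoot (F.map (Int.castRingHom ℚ))) := ⟨⟩
  refine ⟨AdjoinRoot (F.map (Int.castRingHom ℚ)), inferInstance, this,
    exists_primes_absNorm_eq_of_aeval_eq_zero hdeg (r := AdjoinRoot.root _) ?_
      AdjoinRoot.adjoinRoot_eq_top ?_⟩
  · have h := AdjoinRoot.aeval_eq (f := F.map (Int.castRingHom ℚ)) (F.map (Int.castRingHom ℚ))
    rw [AdjoinRoot.mk_self] at h
    rw [← h]
    exact (aeval_map_algebraMap ℚ _ F).symm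
  · rw [(AdjoinRoot.powerBasis hirr.ne_zero).finrank, AdjoinRoot.powerBasis_dim,
      natDegree_map_eq_of_injective Int.cast_injective]

end NumberField

/-! ### Ideal counts and a bound for the Dedekind zeta function near one -/

section IdealCount

open Finset NumberField Ideal

variable (K : Type*) [Field K] [NumberField K]

lemma exists_card_absNorm_le : ∃ C : ℝ, 0 < C ∧ ∀ n : ℕ, 1 ≤ n → ∀ T : Finset (Ideal (𝓞 K)),
    (∀ I ∈ T, absNorm I ≤ n) → (T.card : ℝ) ≤ C * n := by
  have h := NumberField.Ideal.tendsto_norm_le_div_atTop K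
  set κ := (2 ^ InfinitePlace.nrRealPlaces K * (2 * π) ^ InfinitePlace.nrComplexPlaces K *
    Units.regulator K * classNumber K) / (Units.torsionOrder K * √|(NumberField.discr K : ℝ)|)
  obtain ⟨x₀, hx₀⟩ := Filter.eventually_atTop.1 (h.eventually (gt_mem_nhds (lt_add_one κ)))
  set x₁ := max x₀ 1
  have hx₁ : 0 < x₁ := lt_max_of_lt_right one_pos
  have hκ : 0 ≤ κ + 1 := (div_nonneg (Nat.cast_nonneg _) hx₁.le).trans (hx₀ x₁ (le_max_left _ _)).le
  refine ⟨(κ + 2) * (x₁ + 1), mul_pos (by linarith) (by linarith), fun n hn T hT ↦ ?_⟩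
  have hn' : (1 : ℝ) ≤ n := by exact_mod_cast hn
  have hs := hx₀ (x₁ + n) (by linarith [le_max_left x₀ 1])
  rw [div_lt_iff₀ (by positivity)] at hs
  have hcard : (T.card : ℝ) ≤ Nat.card {I : Ideal (𝓞 K) // (absNorm I : ℝ) ≤ x₁ + n} := by
    have hfin : {I : Ideal (𝓞 K) | (absNorm I : ℝ) ≤ x₁ + n}.Finite := by
      refine (Ideal.finite_setOfPred_absNorm_le (S := 𝓞 K) ⌊x₁ + n⌋₊).subset fun I hI ↦ ?_
      exact Nat.le_floor hI
    have := Set.ncard_le_ncard (s := (T : Set (Ideal (𝓞 K)))) (fun I hI ↦ ?_) hfin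
    · rw [Set.ncard_coe_finset] at this
      exact_mod_cast this
    · have : (absNorm I : ℝ) ≤ n := by exact_mod_cast hT I hI
      exact this.trans (by linarith)
  calc (T.card : ℝ) ≤ (κ + 1) * (x₁ + n) := hcard.trans hs.le
    _ ≤ (κ + 2) * (x₁ * n + n) := by gcongr <;> nlinarith
    _ = _ := by ring

lemma exists_sum_absNorm_rpow_le : ∃ C : ℝ, 0 < C ∧ ∀ u : ℝ, 0 < u → u ≤ 1 →
    ∀ T : Finset (Ideal (𝓞 K)), (∀ I ∈ T, I ≠ ⊥) →
      ∑ I ∈ T, (absNorm I : ℝ) ^ (-(1 + u)) ≤ C / u := by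
  obtain ⟨C, hC, hcard⟩ := exists_card_absNorm_le K
  refine ⟨4 * C, by positivity, fun u hu hu1 T hT ↦ ?_⟩
  set r : ℝ := 2 ^ (-u) with hr
  have hr0 : 0 < r := by positivity
  have hr1 : r ≤ 1 - u / 2 := by
    obtain ⟨-, hconv⟩ := convexOn_rpow_left (b := 2) (by norm_num)
    have h := hconv (Set.mem_univ (0 : ℝ)) (Set.mem_univ (-1 : ℝ))
      (sub_nonneg.2 hu1) hu.le (sub_add_cancel 1 u)
    simp only [smul_eq_mul, mul_zero, mul_neg, mul_one, zero_add, Real.rpow_zero,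
      Real.rpow_neg_one] at h
    rw [hr]; linarith
  have hmaps : ∀ I ∈ T, Nat.log 2 (absNorm I) ∈ T.image fun I ↦ Nat.log 2 (absNorm I) :=
    fun I hI ↦ mem_image_of_mem _ hI
  rw [← sum_fiberwise_of_maps_to hmaps]
  have hfib : ∀ i ∈ T.image fun I ↦ Nat.log 2 (absNorm I),
      ∑ I ∈ T with Nat.log 2 (absNorm I) = i, (absNorm I : ℝ) ^ (-(1 + u)) ≤ 2 * C * r ^ i := by
    intro i _
    have hle : ∀ I ∈ T.filter fun I ↦ Nat.log 2 (absNorm I) = i,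
        (absNorm I : ℝ) ^ (-(1 + u)) ≤ ((2 : ℝ) ^ i) ^ (-(1 + u)) := by
      intro I hI
      rw [mem_filter] at hI
      apply Real.rpow_le_rpow_of_nonpos (by positivity) _ (by linarith)
      have := Nat.pow_log_le_self 2 (x := absNorm I)
        (fun h ↦ hT I hI.1 (Ideal.absNorm_eq_zero_iff.1 h))
      rw [hI.2] at this
      exact_mod_cast this
    have hc := hcard (2 ^ (i + 1)) Nat.one_le_two_pow
      (T.filter fun I ↦ Nat.log 2 (absNorm I) = i) (fun I hI ↦ by
        rw [mem_filter] at hI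
        rw [← hI.2]
        exact (Nat.lt_pow_succ_log_self one_lt_two _).le)
    calc _ ≤ _ := sum_le_sum hle
      _ = (T.filter fun I ↦ Nat.log 2 (absNorm I) = i).card * ((2 : ℝ) ^ i) ^ (-(1 + u)) := by
          rw [sum_const, nsmul_eq_mul]
      _ ≤ C * (2 ^ (i + 1) : ℕ) * ((2 : ℝ) ^ i) ^ (-(1 + u)) := by gcongr
      _ = 2 * C * r ^ i := by
          have h1 : ((2 : ℝ) ^ i) ^ (-(1 + u)) = ((2 : ℝ) ^ i)⁻¹ * r ^ i := by
            rw [neg_add, Real.rpow_add (by positivity), Real.rpow_neg_one, hr,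
              ← Real.rpow_natCast_mul (by norm_num), ← Real.rpow_mul_natCast (by norm_num),
              mul_comm (i : ℝ)]
          rw [h1]
          push_cast
          field_simp
          ring
  have hr1' : r < 1 := by linarith
  calc _ ≤ _ := sum_le_sum hfib
    _ = 2 * C * ∑ i ∈ T.image fun I ↦ Nat.log 2 (absNorm I), r ^ i := by rw [mul_sum]
    _ ≤ 2 * C * (1 - r)⁻¹ := by
        gcongr
        rw [← tsum_geometric_of_lt_one hr0.le hr1']
        exact (summable_geometric_of_lt_one hr0.le hr1').sum_le_tsum _ fun i _ ↦ by positivity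
    _ ≤ 2 * C * (u / 2)⁻¹ := by gcongr; linarith
    _ = _ := by field_simp; ring

lemma prod_one_add_eq_sum_prod_primes {Q : Finset (Ideal (𝓞 K))}
    (hQ : ∀ P ∈ Q, P.IsPrime ∧ P ≠ ⊥) (s : ℝ) :
    ∃ T : Finset (Ideal (𝓞 K)), (∀ I ∈ T, I ≠ ⊥) ∧
      ∏ P ∈ Q, (1 + (absNorm P : ℝ) ^ s) = ∑ I ∈ T, (absNorm I : ℝ) ^ s := by
  refine ⟨Q.powerset.image fun t ↦ ∏ P ∈ t, P, ?_, ?_⟩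
  · intro I hI
    obtain ⟨t, ht, rfl⟩ := mem_image.1 hI
    exact prod_ne_zero_iff.2 fun P hP ↦ (hQ P (mem_powerset.1 ht hP)).2
  · have hmem : ∀ t ⊆ Q, ∀ P ∈ Q, P ∈ t ↔ P ∣ ∏ P ∈ t, P := by
      intro t ht P hP
      refine ⟨fun h ↦ dvd_prod_of_mem _ h, fun h ↦ ?_⟩
      obtain ⟨R, hR, hPR⟩ := ((Ideal.prime_of_isPrime (hQ P hP).2 (hQ P hP).1).dvd_finsetProd_iff
        (fun P ↦ P)).1 h
      have hmax := (hQ R (ht hR)).1.isMaximal (hQ R (ht hR)).2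
      rwa [← hmax.eq_of_le (hQ P hP).1.ne_top (Ideal.le_of_dvd hPR)]
    rw [prod_one_add, sum_image]
    · refine sum_congr rfl fun t ht ↦ ?_
      rw [map_prod, Nat.cast_prod, Real.finsetProd_rpow _ _ fun _ _ ↦ by positivity]
    · intro t ht t' ht' h
      have h : ∏ P ∈ t, P = ∏ P ∈ t', P := h
      have ht := mem_powerset.1 ht
      have ht' := mem_powerset.1 ht'
      ext P
      constructor
      · intro hP
        exact (hmem t' ht' P (ht hP)).2 (h ▸ (hmem t ht P (ht hP)).1 hP)
      · intro hP
        exact (hmem t ht P (ht' hP)).2 (h ▸ (hmem t' ht' P (ht' hP)).1 hP)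

end IdealCount

/-! ### An upper Mertens bound for the number of roots modulo primes -/

section Mertens

open Finset

lemma sum_log_div_primes_le (n : ℕ) :
    ∑ p ∈ (Ioc 0 n).filter Nat.Prime, Real.log p / p ≤ Real.log n + Real.log 4 := by
  rcases Nat.eq_zero_or_pos n with rfl | hn
  · simpa using Real.log_nonneg (by norm_num : (1 : ℝ) ≤ 4)
  have hn' : (0 : ℝ) < n := by exact_mod_cast hn
  set S := (Ioc 0 n).filter Nat.Prime with hS
  have h1 : ∑ p ∈ S, ((n / p : ℕ) : ℝ) * Real.log p ≤ n * Real.log n := by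
    calc ∑ p ∈ S, ((n / p : ℕ) : ℝ) * Real.log p
        = ∑ p ∈ S, ∑ k ∈ Ioc 0 n, if p ∣ k then Real.log p else 0 := by
          refine sum_congr rfl fun p _ ↦ ?_
          rw [← sum_filter, sum_const, Nat.Ioc_filter_dvd_card_eq_div, nsmul_eq_mul]
      _ = ∑ k ∈ Ioc 0 n, ∑ p ∈ S, if p ∣ k then Real.log p else 0 := sum_comm
      _ ≤ ∑ k ∈ Ioc 0 n, Real.log n := by
          refine sum_le_sum fun k hk ↦ ?_
          rw [mem_Ioc] at hk
          rw [← sum_filter]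
          have hsub : (S.filter fun p ↦ p ∣ k) ⊆ k.primeFactors := by
            intro p hp
            simp only [hS, mem_filter] at hp
            exact Nat.mem_primeFactors.2 ⟨hp.1.2, hp.2, hk.1.ne'⟩
          calc _ ≤ ∑ p ∈ k.primeFactors, Real.log p :=
                sum_le_sum_of_subset_of_nonneg hsub fun p _ _ ↦ Real.log_natCast_nonneg p
            _ = Real.log (∏ p ∈ k.primeFactors, p : ℕ) := by
                rw [Nat.cast_prod, Real.log_prod fun p hp ↦ by
                  exact_mod_cast (Nat.prime_of_mem_primeFactors hp).ne_zero]
            _ ≤ Real.log n := by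
                have hpos : 0 < ∏ p ∈ k.primeFactors, p :=
                  prod_pos fun p hp ↦ (Nat.prime_of_mem_primeFactors hp).pos
                have hle := (Nat.le_of_dvd hk.1 (Nat.prod_primeFactors_dvd k)).trans hk.2
                gcongr
      _ = n * Real.log n := by simp
  have h2 : ∑ p ∈ S, Real.log p ≤ Real.log 4 * n := by
    have := Chebyshev.theta_le_log4_mul_x hn'.le
    rwa [Chebyshev.theta, Nat.floor_natCast] at this
  have h3 : (n : ℝ) * ∑ p ∈ S, Real.log p / p ≤ n * (Real.log n + Real.log 4) := by
    calc (n : ℝ) * ∑ p ∈ S, Real.log p / p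
        ≤ ∑ p ∈ S, (((n / p : ℕ) : ℝ) * Real.log p + Real.log p) := by
          rw [mul_sum]
          refine sum_le_sum fun p hp ↦ ?_
          have hlog := Real.log_natCast_nonneg p
          have : (n : ℝ) / p ≤ ((n / p : ℕ) : ℝ) + 1 := by
            rw [← Nat.floor_div_eq_div (K := ℝ)]
            exact (Nat.lt_floor_add_one _).le
          calc (n : ℝ) * (Real.log p / p) = n / p * Real.log p := by ring
            _ ≤ (((n / p : ℕ) : ℝ) + 1) * Real.log p := by gcongr
            _ = _ := by ring
      _ ≤ _ := by rw [sum_add_distrib]; linarith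
  exact le_of_mul_le_mul_left h3 hn'

lemma inv_le_log_one_add_rpow {x u : ℝ} (hx : 1 ≤ x) (hu : 0 ≤ u) :
    x⁻¹ ≤ Real.log (1 + x ^ (-(1 + u))) + (x ^ 2)⁻¹ + u * (Real.log x / x) := by
  have hx0 : 0 < x := by linarith
  set t := x ^ (-(1 + u)) with ht
  have ht0 : 0 < t := by positivity
  have htx : t ≤ x⁻¹ := by
    rw [ht, ← Real.rpow_neg_one]
    exact Real.rpow_le_rpow_of_exponent_le hx (by linarith)
  have h1 : t - t ^ 2 ≤ Real.log (1 + t) := by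
    refine le_trans ?_ (Real.le_log_one_add_of_nonneg ht0.le)
    rw [le_div_iff₀ (by positivity)]
    nlinarith [pow_pos ht0 2, pow_pos ht0 3]
  have h2 : t ^ 2 ≤ (x ^ 2)⁻¹ := by
    rw [← inv_pow]; gcongr
  have h3 : x⁻¹ - u * (Real.log x / x) ≤ t := by
    rw [ht, neg_add, Real.rpow_add hx0, Real.rpow_neg_one, Real.rpow_def_of_pos hx0]
    have := Real.add_one_le_exp (Real.log x * -u)
    calc x⁻¹ - u * (Real.log x / x) = x⁻¹ * (Real.log x * -u + 1) := by ring
      _ ≤ _ := by gcongr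
  linarith

lemma sum_mul_log_one_add_le_of_primes {K : Type*} [Field K] [NumberField K] {ρ : ℕ → ℕ} {A u : ℝ}
    (hA : ∀ T : Finset (Ideal (NumberField.RingOfIntegers K)), (∀ I ∈ T, I ≠ ⊥) →
      ∑ I ∈ T, (Ideal.absNorm I : ℝ) ^ (-(1 + u)) ≤ A)
    (S : Finset ℕ) (hS : ∀ p ∈ S, p.Prime ∧
      ∃ Q : Finset (Ideal (NumberField.RingOfIntegers K)), Q.card = ρ p ∧
        ∀ P ∈ Q, P.IsPrime ∧ Ideal.absNorm P = p) :
    ∑ p ∈ S, (ρ p : ℝ) * Real.log (1 + (p : ℝ) ^ (-(1 + u))) ≤ Real.log A := by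
  have hpos : ∀ p : ℕ, 0 < 1 + (p : ℝ) ^ (-(1 + u)) := fun p ↦ by positivity
  choose! hp Q hcard hQ using hS
  have hdisj : (S : Set ℕ).PairwiseDisjoint Q := by
    intro p hpS q hqS hpq
    rw [Function.onFun, disjoint_left]
    intro P hP hP'
    exact hpq ((hQ p hpS P hP).2.symm.trans (hQ q hqS P hP').2)
  obtain ⟨T, hT, hprod⟩ := prod_one_add_eq_sum_prod_primes K (Q := S.biUnion Q) (fun P hP ↦ by
    obtain ⟨p, hpS, hP⟩ := mem_biUnion.1 hP
    refine ⟨(hQ p hpS P hP).1, ?_⟩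
    rintro rfl
    exact (hp p hpS).ne_zero ((hQ p hpS _ hP).2.symm.trans Ideal.absNorm_bot)) (-(1 + u))
  have heq : ∏ P ∈ S.biUnion Q, (1 + (Ideal.absNorm P : ℝ) ^ (-(1 + u))) =
      ∏ p ∈ S, (1 + (p : ℝ) ^ (-(1 + u))) ^ ρ p := by
    rw [prod_biUnion hdisj]
    refine prod_congr rfl fun p hpS ↦ ?_
    rw [← hcard p hpS, ← prod_const]
    exact prod_congr rfl fun P hP ↦ by rw [(hQ p hpS P hP).2]
  calc ∑ p ∈ S, (ρ p : ℝ) * Real.log (1 + (p : ℝ) ^ (-(1 + u)))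
      = Real.log (∏ p ∈ S, (1 + (p : ℝ) ^ (-(1 + u))) ^ ρ p) := by
        rw [Real.log_prod fun p _ ↦ (pow_pos (hpos p) _).ne']
        simp_rw [Real.log_pow]
    _ ≤ Real.log A := by
        apply Real.log_le_log (prod_pos fun p _ ↦ pow_pos (hpos p) _)
        rw [← heq, hprod]
        exact hA T hT

theorem exists_sum_polyRho_div_le {F : Polynomial ℤ} (hF : Irreducible F) (hdeg : 1 ≤ F.natDegree) :
    ∃ C : ℝ, ∀ n : ℕ, 2 ≤ n →
      ∑ p ∈ (Ioc 0 n).filter Nat.Prime, (polyRho F p : ℝ) / p ≤ Real.log (Real.log n) + C := by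
  obtain ⟨K, _, _, B, hB, hQ⟩ := exists_numberField_primes_absNorm_eq hF hdeg
  obtain ⟨A, hA, hsum⟩ := exists_sum_absNorm_rpow_le K
  set g := F.natDegree
  have hρ : ∀ p : ℕ, p.Prime → (polyRho F p : ℝ) ≤ g := fun p hp ↦ by
    exact_mod_cast polyRho_prime_le_natDegree (hF.isPrimitive (by omega)) hp
  have hZ : Summable fun n : ℕ ↦ ((n : ℝ) ^ 2)⁻¹ := Real.summable_nat_pow_inv.2 one_lt_two
  set Z := ∑' n : ℕ, ((n : ℝ) ^ 2)⁻¹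
  refine ⟨Real.log (2 * A) + g * Z + g * 2 + g * B.divisors.card, fun n hn ↦ ?_⟩
  have hn' : (2 : ℝ) ≤ n := by exact_mod_cast hn
  have hlog : 1 / 2 ≤ Real.log n := by
    have := Real.log_le_log (by norm_num) hn'
    linarith [Real.log_two_gt_d9]
  set u := 1 / (2 * Real.log n) with hu
  have hu0 : 0 < u := by positivity
  have hu1 : u ≤ 1 := by
    rw [hu, div_le_one (by positivity)]; linarith
  set S := (Ioc 0 n).filter Nat.Prime with hS
  have hSp : ∀ p ∈ S, p.Prime := fun p hp ↦ (mem_filter.1 hp).2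
  rw [← sum_filter_add_sum_filter_not S (fun p ↦ p ∣ B)]
  have hbad : ∑ p ∈ S.filter (fun p ↦ p ∣ B), (polyRho F p : ℝ) / p ≤ g * B.divisors.card := by
    calc ∑ p ∈ S.filter (fun p ↦ p ∣ B), (polyRho F p : ℝ) / p
        ≤ ∑ p ∈ S.filter (fun p ↦ p ∣ B), (g : ℝ) := by
          refine sum_le_sum fun p hp ↦ ?_
          have hp := hSp p (mem_filter.1 hp).1
          exact (div_le_self (by positivity) (by exact_mod_cast hp.one_le)).trans (hρ p hp)
      _ ≤ ∑ p ∈ B.divisors, (g : ℝ) := by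
          refine sum_le_sum_of_subset_of_nonneg (fun p hp ↦ ?_) fun _ _ _ ↦ by positivity
          exact Nat.mem_divisors.2 ⟨(mem_filter.1 hp).2, hB⟩
      _ = _ := by rw [sum_const, nsmul_eq_mul, mul_comm]
  set S' := S.filter (fun p ↦ ¬ p ∣ B)
  have hS' : S' ⊆ S := filter_subset _ _
  have hmain := sum_mul_log_one_add_le_of_primes (ρ := polyRho F) (hsum u hu0 hu1) S'
    fun p hp ↦ ⟨hSp p (hS' hp), hQ p (hSp p (hS' hp)) (mem_filter.1 hp).2⟩
  have hA' : A / u = 2 * A * Real.log n := by rw [hu]; field_simp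
  rw [hA', Real.log_mul (by positivity) (by positivity)] at hmain
  have hgood : ∑ p ∈ S', (polyRho F p : ℝ) / p ≤
      ∑ p ∈ S', (polyRho F p : ℝ) * Real.log (1 + (p : ℝ) ^ (-(1 + u))) +
        g * ∑ p ∈ S', ((p : ℝ) ^ 2)⁻¹ + g * (u * ∑ p ∈ S', Real.log p / p) := by
    simp_rw [mul_sum]
    rw [← sum_add_distrib, ← sum_add_distrib]
    refine sum_le_sum fun p hp ↦ ?_
    have hp := hSp p (hS' hp)
    have hlogp := Real.log_natCast_nonneg p
    have h := inv_le_log_one_add_rpow (x := p) (by exact_mod_cast hp.one_le) hu0.le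
    calc (polyRho F p : ℝ) / p = polyRho F p * (p : ℝ)⁻¹ := div_eq_mul_inv _ _
      _ ≤ polyRho F p * (Real.log (1 + (p : ℝ) ^ (-(1 + u))) + ((p : ℝ) ^ 2)⁻¹ +
          u * (Real.log p / p)) := by gcongr
      _ = polyRho F p * Real.log (1 + (p : ℝ) ^ (-(1 + u))) + polyRho F p * ((p : ℝ) ^ 2)⁻¹ +
          polyRho F p * (u * (Real.log p / p)) := by ring
      _ ≤ _ := by
          have := hρ p hp
          gcongr
  have h2 : ∑ p ∈ S', ((p : ℝ) ^ 2)⁻¹ ≤ Z := hZ.sum_le_tsum _ fun _ _ ↦ by positivity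
  have h3 : u * ∑ p ∈ S', Real.log p / p ≤ 2 := by
    have : ∑ p ∈ S', Real.log p / p ≤ Real.log n + Real.log 4 :=
      (sum_le_sum_of_subset_of_nonneg hS' fun p _ _ ↦
        div_nonneg (Real.log_natCast_nonneg p) (by positivity)).trans (sum_log_div_primes_le n)
    have h4 : Real.log 4 ≤ 2 * Real.log n := by
      rw [show (4 : ℝ) = 2 ^ 2 by norm_num, Real.log_pow]
      push_cast
      gcongr
    rw [hu, one_div, inv_mul_le_iff₀ (by positivity)]
    linarith
  have h2' : (g : ℝ) * ∑ p ∈ S', ((p : ℝ) ^ 2)⁻¹ ≤ g * Z := by gcongr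
  have h3' : (g : ℝ) * (u * ∑ p ∈ S', Real.log p / p) ≤ g * 2 := by gcongr
  linarith

end Mertens

/-! ### Growth of a greedy partition of the primes -/

section GreedyPartition

open Finset

variable {w : ℕ → ℝ} {g C : ℝ}

lemma log_two_sub_le_sum_of_maximal (hw : ∀ p, p.Prime → w p ≤ g / p) (hg : 0 ≤ g) {a b : ℕ}
    (hb : 0 < b) (hab : a < b)
    (hmax : ∀ q : ℕ, q.Prime → a < q → ∑ p ∈ (Ioc a q).filter Nat.Prime, w p ≤ Real.log 2 → q ≤ b) :
    Real.log 2 - g / b ≤ ∑ p ∈ (Ioc a b).filter Nat.Prime, w p := by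
  have hex : ∃ q, b < q ∧ q.Prime := by
    obtain ⟨q, hq, hqp⟩ := Nat.exists_infinite_primes (b + 1)
    exact ⟨q, hq, hqp⟩
  obtain ⟨hbq, hqp⟩ := Nat.find_spec hex
  set q := Nat.find hex
  have hsplit : (Ioc a q).filter Nat.Prime = insert q ((Ioc a b).filter Nat.Prime) := by
    ext p
    simp only [mem_filter, mem_Ioc, mem_insert]
    constructor
    · rintro ⟨⟨h1, h2⟩, hp⟩
      by_cases hpb : p ≤ b
      · exact Or.inr ⟨⟨h1, hpb⟩, hp⟩
      · exact Or.inl (le_antisymm h2 (Nat.find_min' hex ⟨not_le.1 hpb, hp⟩))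
    · rintro (rfl | ⟨⟨h1, h2⟩, hp⟩)
      · exact ⟨⟨hab.trans hbq, le_rfl⟩, hqp⟩
      · exact ⟨⟨h1, h2.trans hbq.le⟩, hp⟩
  have hgt : Real.log 2 < ∑ p ∈ (Ioc a q).filter Nat.Prime, w p :=
    not_le.1 fun h ↦ (hmax q hqp (hab.trans hbq) h).not_gt hbq
  rw [hsplit, sum_insert (by simp [hbq])] at hgt
  have hwq : w q ≤ g / b := (hw q hqp).trans (by gcongr)
  linarith

theorem exists_mul_two_pow_le_log (hw0 : ∀ p, 0 ≤ w p) (hw : ∀ p, p.Prime → w p ≤ g / p)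
    (hg : 0 ≤ g)
    (hC : ∀ n : ℕ, 2 ≤ n → ∑ p ∈ (Ioc 0 n).filter Nat.Prime, w p ≤ Real.log (Real.log n) + C) :
    ∃ c : ℝ, 0 < c ∧ ∀ lam : ℕ → ℕ, 2 ≤ lam 0 → 4 * g ≤ lam 0 → (∀ j, lam j < lam (j + 1)) →
      (∀ j q, q.Prime → lam j < q →
        ∑ p ∈ (Ioc (lam j) q).filter Nat.Prime, w p ≤ Real.log 2 → q ≤ lam (j + 1)) →
      ∀ j, c * 2 ^ j ≤ Real.log (lam j) := by
  set r := Real.exp (-(Real.log 2 / 2)) with hr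
  have hlog2 := Real.log_two_gt_d9
  have hr1 : r < 1 := Real.exp_lt_one_iff.2 (by linarith)
  have hr0 : 0 < r := Real.exp_pos _
  set K := g * Real.exp C * (1 - r)⁻¹ + C with hK
  refine ⟨Real.exp (-K), Real.exp_pos _, fun lam h2 h4 hlt hmax ↦ ?_⟩
  have hmono : StrictMono lam := strictMono_nat_of_lt_succ hlt
  have hlam2 : ∀ j, 2 ≤ lam j := fun j ↦ h2.trans (hmono.monotone (Nat.zero_le j))
  have hlamR : ∀ j, (2 : ℝ) ≤ lam j := fun j ↦ by exact_mod_cast hlam2 j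
  have hlogpos : ∀ j, 0 < Real.log (lam j) := fun j ↦ Real.log_pos (by linarith [hlamR j])
  have hlow : ∀ j, Real.log 2 - g / lam (j + 1) ≤
      ∑ p ∈ (Ioc (lam j) (lam (j + 1))).filter Nat.Prime, w p := fun j ↦
    log_two_sub_le_sum_of_maximal hw hg (by linarith [hlam2 (j + 1)]) (hlt j) (hmax j)
  have hsum : ∀ j, ∑ i ∈ range j, (Real.log 2 - g / lam (i + 1)) ≤
      Real.log (Real.log (lam j)) + C := by
    intro j
    refine le_trans ?_ (hC (lam j) (hlam2 j))
    induction j with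
    | zero => simpa using sum_nonneg fun p _ ↦ hw0 p
    | succ j ih =>
      rw [sum_range_succ, ← Ioc_union_Ioc_eq_Ioc (Nat.zero_le (lam j)) (hlt j).le, filter_union,
        sum_union]
      · exact add_le_add ih (hlow j)
      · exact disjoint_filter_filter (Ioc_disjoint_Ioc_of_le le_rfl)
  have hdiv : ∀ j, g / lam j ≤ 1 / 4 := fun j ↦ by
    rw [div_le_iff₀ (by linarith [hlamR j])]
    have : (lam 0 : ℝ) ≤ lam j := by exact_mod_cast hmono.monotone (Nat.zero_le j)
    linarith
  have hweak : ∀ j : ℕ, (1 : ℝ) / lam j ≤ Real.exp C * r ^ j := by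
    intro j
    have h1 : (j : ℝ) * (Real.log 2 / 2) ≤ Real.log (Real.log (lam j)) + C := by
      refine le_trans ?_ (hsum j)
      calc (j : ℝ) * (Real.log 2 / 2) = ∑ i ∈ range j, (Real.log 2 / 2) := by simp
        _ ≤ _ := sum_le_sum fun i _ ↦ by linarith [hdiv (i + 1)]
    have h3 : Real.exp (j * (Real.log 2 / 2) - C) ≤ lam j := by
      calc _ ≤ Real.exp (Real.log (Real.log (lam j))) := Real.exp_le_exp.2 (by linarith)
        _ = Real.log (lam j) := Real.exp_log (hlogpos j)
        _ ≤ lam j := Real.log_le_self (by positivity)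
    rw [div_le_iff₀ (by linarith [hlamR j])]
    calc (1 : ℝ) = Real.exp C * r ^ j * Real.exp (j * (Real.log 2 / 2) - C) := by
          rw [hr, ← Real.exp_nat_mul, ← Real.exp_add, ← Real.exp_add]
          ring_nf
          simp
      _ ≤ _ := by gcongr
  intro j
  have hgeom : ∑ i ∈ range j, g / lam (i + 1) ≤ g * Real.exp C * (1 - r)⁻¹ := by
    calc ∑ i ∈ range j, g / lam (i + 1) ≤ ∑ i ∈ range j, g * Real.exp C * r ^ i := by
          refine sum_le_sum fun i _ ↦ ?_
          have h := hweak (i + 1)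
          have h' : r ^ (i + 1) ≤ r ^ i := pow_le_pow_of_le_one hr0.le hr1.le (Nat.le_succ i)
          calc g / lam (i + 1) = g * (1 / lam (i + 1)) := by ring
            _ ≤ g * (Real.exp C * r ^ (i + 1)) := by gcongr
            _ ≤ g * (Real.exp C * r ^ i) := by gcongr
            _ = _ := by ring
      _ = g * Real.exp C * ∑ i ∈ range j, r ^ i := by rw [mul_sum]
      _ ≤ g * Real.exp C * (1 - r)⁻¹ := by
          have := (summable_geometric_of_lt_one hr0.le hr1).sum_le_tsum (range j)
            fun i _ ↦ by positivity
          rw [tsum_geometric_of_lt_one hr0.le hr1] at this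
          gcongr
  have hj := hsum j
  rw [sum_sub_distrib] at hj
  simp only [sum_const, card_range, nsmul_eq_mul] at hj
  calc Real.exp (-K) * 2 ^ j = Real.exp (j * Real.log 2 - K) := by
        rw [sub_eq_neg_add, Real.exp_add, Real.exp_nat_mul, Real.exp_log two_pos]
    _ ≤ Real.exp (Real.log (Real.log (lam j))) := Real.exp_le_exp.2 (by linarith)
    _ = _ := Real.exp_log (hlogpos j)

end GreedyPartition

/-! ### Close pairs of sub-products over tuples of primes -/

section Tuples

open Finset

variable {ι : Type*} [DecidableEq ι] {P : ι → Finset ℕ}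

lemma sum_sub_sum_update_eq (r : ι → ℕ) (i₀ : ι) (n : ℕ) (Y Z : Finset ι)
    (f : ℕ → ℝ) (hY : i₀ ∈ Y) (hZ : i₀ ∉ Z) :
    ∑ i ∈ Y, f (Function.update r i₀ n i) - ∑ i ∈ Z, f (Function.update r i₀ n i) =
      f n + (∑ i ∈ Y.erase i₀, f (r i) - ∑ i ∈ Z, f (r i)) := by
  rw [← add_sum_erase Y _ hY, Function.update_self, add_sub_assoc]
  congr 2
  · exact sum_congr rfl fun i hi ↦ by rw [Function.update_of_ne (ne_of_mem_erase hi)]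
  · exact sum_congr rfl fun i hi ↦ by rw [Function.update_of_ne (ne_of_mem_of_not_mem hi hZ)]

lemma exists_window_of_abs_sub_le (hP : ∀ i, ∀ p ∈ P i, 0 < p) (η : ℝ) {Y Z : Finset ι} {i₀ : ι}
    (hi₀ : i₀ ∈ symmDiff Y Z) (r : ι → ℕ) :
    ∃ V : ℝ, ∀ n ∈ P i₀,
      |∑ i ∈ Y, Real.log (Function.update r i₀ n i) - ∑ i ∈ Z, Real.log (Function.update r i₀ n i)|
        ≤ η → V ≤ n ∧ (n : ℝ) ≤ V * Real.exp (2 * η) := by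
  wlog h : i₀ ∈ Y ∧ i₀ ∉ Z generalizing Y Z
  · rw [mem_symmDiff] at hi₀
    obtain ⟨V, hV⟩ := this (mem_symmDiff.2 hi₀.symm) (hi₀.resolve_left h)
    exact ⟨V, fun n hn hle ↦ hV n hn (by rwa [abs_sub_comm])⟩
  set c := ∑ i ∈ Y.erase i₀, Real.log (r i) - ∑ i ∈ Z, Real.log (r i) with hc
  refine ⟨Real.exp (-c - η), fun n hn hle ↦ ?_⟩
  rw [sum_sub_sum_update_eq r i₀ n Y Z (fun n ↦ Real.log n) h.1 h.2, ← hc, abs_le] at hle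
  have hn0 : (0 : ℝ) < n := by exact_mod_cast hP i₀ n hn
  rw [← Real.exp_add, ← Real.exp_log hn0, Real.exp_le_exp, Real.exp_le_exp]
  constructor <;> linarith

variable [Fintype ι] {w : ℕ → ℝ} {ℓ : ℝ}

lemma sum_piFinset_prod_le (hw : ∀ n, 0 ≤ w n) (hℓ : ∀ i, ∑ p ∈ P i, w p ≤ ℓ) :
    ∑ p ∈ Fintype.piFinset P, ∏ i, w (p i) ≤ ℓ ^ Fintype.card ι := by
  rw [← prod_univ_sum P fun _ n ↦ w n, Fintype.card, ← prod_const]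
  exact prod_le_prod (fun i _ ↦ sum_nonneg fun n _ ↦ hw n) fun i _ ↦ hℓ i

/-- If fixing all coordinates but one confines the remaining one to a set of weight at most `T`,
then the total weight loses a factor `T / ℓ`. -/
lemma sum_piFinset_filter_prod_le (hw : ∀ n, 0 ≤ w n) (hℓ : ∀ i, ∑ p ∈ P i, w p ≤ ℓ) (i₀ : ι)
    (Q : (ι → ℕ) → Prop) {T : ℝ} (hT : 0 ≤ T)
    (hQ : ∀ r : ι → ℕ, ∑ n ∈ P i₀ with Q (Function.update r i₀ n), w n ≤ T) :
    ∑ p ∈ Fintype.piFinset P with Q p, ∏ i, w (p i) ≤ ℓ ^ (Fintype.card ι - 1) * T := by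
  set P' := Function.update P i₀ {0} with hP'
  have hmaps : ∀ p ∈ (Fintype.piFinset P).filter Q,
      Function.update p i₀ 0 ∈ Fintype.piFinset P' := by
    intro p hp
    rw [mem_filter, Fintype.mem_piFinset] at hp
    rw [Fintype.mem_piFinset]
    intro i
    by_cases hi : i = i₀
    · subst hi; simp [hP']
    · simpa [hP', hi] using hp.1 i
  rw [← sum_fiberwise_of_maps_to hmaps]
  have hfib : ∀ r ∈ Fintype.piFinset P',
      ∑ p ∈ (Fintype.piFinset P).filter Q with Function.update p i₀ 0 = r, ∏ i, w (p i) ≤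
        (∏ i ∈ univ.erase i₀, w (r i)) * T := by
    intro r _
    calc ∑ p ∈ (Fintype.piFinset P).filter Q with Function.update p i₀ 0 = r, ∏ i, w (p i)
        ≤ ∑ p ∈ ((P i₀).filter fun n ↦ Q (Function.update r i₀ n)).image
            (fun n ↦ Function.update r i₀ n), ∏ i, w (p i) := by
          refine sum_le_sum_of_subset_of_nonneg (fun p hp ↦ ?_)
            fun p _ _ ↦ prod_nonneg fun i _ ↦ hw _
          simp only [mem_filter, Fintype.mem_piFinset] at hp
          obtain ⟨⟨hp, hQp⟩, rfl⟩ := hp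
          exact mem_image.2 ⟨p i₀, by simpa [hp i₀] using hQp, by simp⟩
      _ = ∑ n ∈ P i₀ with Q (Function.update r i₀ n), ∏ i, w (Function.update r i₀ n i) :=
          sum_image fun x _ y _ h ↦ Function.update_injective r i₀ h
      _ = (∏ i ∈ univ.erase i₀, w (r i)) * ∑ n ∈ P i₀ with Q (Function.update r i₀ n), w n := by
          rw [mul_sum]
          refine sum_congr rfl fun n _ ↦ ?_
          rw [← mul_prod_erase univ _ (mem_univ i₀), mul_comm, Function.update_self]
          congr 1
          exact prod_congr rfl fun i hi ↦ by rw [Function.update_of_ne (ne_of_mem_erase hi)]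
      _ ≤ _ := mul_le_mul_of_nonneg_left (hQ r) (prod_nonneg fun i _ ↦ hw _)
  refine (sum_le_sum hfib).trans ?_
  rw [← sum_mul]
  refine mul_le_mul_of_nonneg_right ?_ hT
  have hone : ∀ r : ι → ℕ, ∏ i ∈ univ.erase i₀, w (r i) =
      ∏ i, (fun i n ↦ if i = i₀ then 1 else w n) i (r i) := by
    intro r
    rw [← mul_prod_erase univ _ (mem_univ i₀)]
    simp only [if_true, one_mul]
    exact prod_congr rfl fun i hi ↦ by rw [if_neg (ne_of_mem_erase hi)]
  simp_rw [hone]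
  rw [← prod_univ_sum P' fun i n ↦ if i = i₀ then 1 else w n,
    ← mul_prod_erase univ _ (mem_univ i₀)]
  have hcard : Fintype.card ι - 1 = (univ.erase i₀).card := by
    rw [card_erase_of_mem (mem_univ i₀), Fintype.card]
  rw [hcard, ← prod_const]
  simp only [if_true, hP', Function.update_self, sum_singleton, one_mul]
  refine prod_le_prod (fun i hi ↦ ?_) fun i hi ↦ ?_
  · simp only [if_neg (ne_of_mem_erase hi)]
    exact sum_nonneg fun n _ ↦ hw n
  · simp only [if_neg (ne_of_mem_erase hi)]
    rw [Function.update_of_ne (ne_of_mem_erase hi)]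
    exact hℓ i

/-- Weighted count of the pairs of sub-products of `∏ i, p i` that lie within a factor `exp η` of
each other, over all tuples `p`. -/
theorem sum_piFinset_card_mul_prod_le [Nonempty ι] (hw : ∀ n, 0 ≤ w n) (hℓ0 : 0 ≤ ℓ)
    (hℓ : ∀ i, ∑ p ∈ P i, w p ≤ ℓ) (hP : ∀ i, ∀ p ∈ P i, 0 < p) (η : ℝ) {J : ι → ℕ} {R : Finset ℕ}
    (hJ : ∀ i, J i ∈ R) {T : ℕ → ℝ} (hT0 : ∀ j, 0 ≤ T j)
    (hT : ∀ i, ∀ V : ℝ, ∀ S ⊆ P i, (∀ n ∈ S, V ≤ n ∧ (n : ℝ) ≤ V * Real.exp (2 * η)) →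
      ∑ n ∈ S, w n ≤ T (J i)) :
    ∑ p ∈ Fintype.piFinset P,
        ((univ.filter fun Y : Finset ι × Finset ι ↦
          |∑ i ∈ Y.1, Real.log (p i) - ∑ i ∈ Y.2, Real.log (p i)| ≤ η).card : ℝ) *
          ∏ i, w (p i) ≤
      2 ^ Fintype.card ι * (ℓ ^ Fintype.card ι + ℓ ^ (Fintype.card ι - 1) *
        ∑ j ∈ R, T j * 2 ^ (univ.filter fun i ↦ J i ≤ j).card) := by
  set k := Fintype.card ι
  set Q : Finset ι × Finset ι → (ι → ℕ) → Prop := fun Y p ↦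
    |∑ i ∈ Y.1, Real.log (p i) - ∑ i ∈ Y.2, Real.log (p i)| ≤ η
  have hswap : ∑ p ∈ Fintype.piFinset P, ((univ.filter fun Y ↦ Q Y p).card : ℝ) * ∏ i, w (p i) =
      ∑ Y : Finset ι × Finset ι, ∑ p ∈ Fintype.piFinset P with Q Y p, ∏ i, w (p i) := by
    simp_rw [card_filter, Nat.cast_sum, sum_mul, sum_filter]
    rw [sum_comm]
    refine sum_congr rfl fun Y _ ↦ sum_congr rfl fun p _ ↦ ?_
    split_ifs <;> simp
  rw [hswap, ← sum_filter_add_sum_filter_not univ fun Y : Finset ι × Finset ι ↦ Y.1 = Y.2, mul_add]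
  refine add_le_add ?_ ?_
  · calc ∑ Y : Finset ι × Finset ι with Y.1 = Y.2,
          ∑ p ∈ Fintype.piFinset P with Q Y p, ∏ i, w (p i)
        ≤ ∑ Y : Finset ι × Finset ι with Y.1 = Y.2, ℓ ^ k := by
          refine sum_le_sum fun Y _ ↦ le_trans ?_ (sum_piFinset_prod_le hw hℓ)
          exact sum_le_sum_of_subset_of_nonneg (filter_subset _ _)
            fun p _ _ ↦ prod_nonneg fun i _ ↦ hw _
      _ ≤ 2 ^ k * ℓ ^ k := by
          rw [sum_const, nsmul_eq_mul]
          refine mul_le_mul_of_nonneg_right ?_ (by positivity)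
          have : (univ.filter fun Y : Finset ι × Finset ι ↦ Y.1 = Y.2).card ≤
              (univ : Finset (Finset ι)).card :=
            card_le_card_of_injOn Prod.fst (fun _ _ ↦ mem_coe.2 (mem_univ _)) fun Y hY Z hZ h ↦ by
              rw [mem_coe, mem_filter] at hY hZ
              exact Prod.ext h (hY.2.symm.trans (h.trans hZ.2))
          rw [card_univ, Fintype.card_finset] at this
          exact_mod_cast this
  · have hmax : ∀ Y : Finset ι × Finset ι, Y.1 ≠ Y.2 →
        ∃ i₀ ∈ symmDiff Y.1 Y.2, ∀ i ∈ symmDiff Y.1 Y.2, J i ≤ J i₀ := fun Y hY ↦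
      exists_max_image _ J (nonempty_iff_ne_empty.2 fun h ↦ hY (symmDiff_eq_bot.1 h))
    choose! I hI hImax using hmax
    set N := univ.filter fun Y : Finset ι × Finset ι ↦ ¬ Y.1 = Y.2
    have hN : ∀ Y ∈ N, Y.1 ≠ Y.2 := fun Y hY ↦ (mem_filter.1 hY).2
    have hcard : ∀ j, ((N.filter fun Y ↦ J (I Y) = j).card : ℝ) ≤
        2 ^ k * 2 ^ (univ.filter fun i ↦ J i ≤ j).card := by
      intro j
      have : (N.filter fun Y ↦ J (I Y) = j).card ≤
          ((univ : Finset (Finset ι)) ×ˢ (univ.filter fun i ↦ J i ≤ j).powerset).card := by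
        refine card_le_card_of_injOn (fun Y ↦ (Y.1, symmDiff Y.1 Y.2)) (fun Y hY ↦ ?_)
          fun Y _ Z _ h ↦ ?_
        · rw [mem_coe, mem_filter] at hY
          rw [mem_coe, mem_product, mem_powerset]
          refine ⟨mem_univ _, fun i hi ↦ mem_filter.2 ⟨mem_univ _, ?_⟩⟩
          exact hY.2 ▸ hImax Y (hN Y hY.1) i hi
        · simp only [Prod.mk.injEq] at h
          exact Prod.ext h.1 (symmDiff_right_injective Y.1 (by simpa [h.1] using h.2))
      rw [card_product, card_univ, Fintype.card_finset, card_powerset] at this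
      exact_mod_cast this
    calc ∑ Y ∈ N, ∑ p ∈ Fintype.piFinset P with Q Y p, ∏ i, w (p i)
        ≤ ∑ Y ∈ N, ℓ ^ (k - 1) * T (J (I Y)) := by
          refine sum_le_sum fun Y hY ↦
            sum_piFinset_filter_prod_le hw hℓ (I Y) (Q Y) (hT0 _) fun r ↦ ?_
          obtain ⟨V, hV⟩ := exists_window_of_abs_sub_le hP η (hI Y (hN Y hY)) r
          refine hT (I Y) V _ (filter_subset _ _) fun n hn ↦ ?_
          rw [mem_filter] at hn
          exact hV n hn.1 hn.2
      _ = ∑ j ∈ R, ∑ Y ∈ N with J (I Y) = j, ℓ ^ (k - 1) * T j := by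
          rw [← sum_fiberwise_of_maps_to (t := R) fun Y _ ↦ hJ (I Y)]
          refine sum_congr rfl fun j _ ↦ sum_congr rfl fun Y hY ↦ ?_
          rw [(mem_filter.1 hY).2]
      _ ≤ ∑ j ∈ R, 2 ^ k * 2 ^ (univ.filter fun i ↦ J i ≤ j).card * (ℓ ^ (k - 1) * T j) := by
          refine sum_le_sum fun j _ ↦ ?_
          rw [sum_const, nsmul_eq_mul]
          exact mul_le_mul_of_nonneg_right (hcard j) (mul_nonneg (by positivity) (hT0 j))
      _ = _ := by
          rw [mul_sum, mul_sum]
          exact sum_congr rfl fun j _ ↦ by ring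

end Tuples

/-! ### Parametrizing squarefree integers by tuples of primes -/

section TupleParametrization

open Finset

lemma exists_prod_eq_of_dvd_prod {ι : Type*} [DecidableEq ι] {p : ι → ℕ} {s : Finset ι}
    (hp : ∀ i ∈ s, (p i).Prime) {d : ℕ} (hd : d ∣ ∏ i ∈ s, p i) :
    ∃ Y ⊆ s, d = ∏ i ∈ Y, p i := by
  induction s using Finset.induction_on generalizing d with
  | empty => exact ⟨∅, subset_rfl, by simpa using hd⟩
  | insert i s his ih =>
    rw [prod_insert his] at hd
    obtain ⟨d₁, d₂, h₁, h₂, rfl⟩ := exists_dvd_and_dvd_of_dvd_mul hd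
    obtain ⟨Y, hY, rfl⟩ := ih (fun j hj ↦ hp j (mem_insert_of_mem hj)) h₂
    rcases (Nat.dvd_prime (hp i (mem_insert_self i s))).1 h₁ with rfl | rfl
    · exact ⟨Y, hY.trans (subset_insert i s), one_mul _⟩
    · exact ⟨insert i Y, insert_subset_insert i hY, (prod_insert fun h ↦ his (hY h)).symm⟩

lemma polyRho_prod_le (F : Polynomial ℤ) {ι : Type*} [DecidableEq ι] {p : ι → ℕ} {s : Finset ι}
    (hsq : Squarefree (∏ i ∈ s, p i)) :
    polyRho F (∏ i ∈ s, p i) ≤ ∏ i ∈ s, polyRho F (p i) := by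
  induction s using Finset.induction_on with
  | empty => simp [polyRho_one]
  | insert i s his ih =>
    rw [prod_insert his] at hsq ⊢
    rw [prod_insert his]
    have hcop := (Nat.squarefree_mul_iff.1 hsq).1
    have hne := mul_ne_zero_iff.1 hsq.ne_zero
    exact (polyRho_mul_le F hne.1 hne.2 hcop).trans
      (Nat.mul_le_mul_left _ (ih (Nat.squarefree_mul_iff.1 hsq).2.2))

variable {ι : Type*} [Fintype ι] [DecidableEq ι] {p : ι → ℕ}

lemma Wfun_prod_le (hp : ∀ i, (p i).Prime) (η : ℝ) :
    Wfun (∏ i, p i) η ≤ (univ.filter fun Y : Finset ι × Finset ι ↦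
      |∑ i ∈ Y.1, Real.log (p i) - ∑ i ∈ Y.2, Real.log (p i)| ≤ η).card := by
  have hlog : ∀ Y : Finset ι, Real.log ((∏ i ∈ Y, p i : ℕ) : ℝ) = ∑ i ∈ Y, Real.log (p i) := by
    intro Y
    rw [Nat.cast_prod, Real.log_prod fun i _ ↦ by exact_mod_cast (hp i).ne_zero]
  have hne : ∀ Y : Finset ι, ((∏ i ∈ Y, p i : ℕ) : ℝ) ≠ 0 := fun Y ↦
    Nat.cast_ne_zero.2 (prod_ne_zero_iff.2 fun i _ ↦ (hp i).ne_zero)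
  rw [Wfun]
  set N := univ.filter fun Y : Finset ι × Finset ι ↦
      |∑ i ∈ Y.1, Real.log (p i) - ∑ i ∈ Y.2, Real.log (p i)| ≤ η
  calc _ ≤ ((N.image fun Y ↦ (∏ i ∈ Y.1, p i, ∏ i ∈ Y.2, p i) : Finset (ℕ × ℕ)) :
          Set (ℕ × ℕ)).ncard := by
        refine Set.ncard_le_ncard ?_ (finite_toSet _)
        rintro ⟨d, d'⟩ ⟨hd, hd', hle⟩
        obtain ⟨Y, -, rfl⟩ := exists_prod_eq_of_dvd_prod (fun i _ ↦ hp i) hd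
        obtain ⟨Z, -, rfl⟩ := exists_prod_eq_of_dvd_prod (fun i _ ↦ hp i) hd'
        rw [Real.log_div (hne Y) (hne Z), hlog, hlog] at hle
        exact mem_coe.2 (mem_image.2 ⟨(Y, Z), mem_filter.2 ⟨mem_univ _, hle⟩, rfl⟩)
    _ = _ := Set.ncard_coe_finset _
    _ ≤ N.card := card_image_le

lemma Wfun_mul_polyRho_div_le (F : Polynomial ℤ) (hp : ∀ i, (p i).Prime)
    (hsq : Squarefree (∏ i, p i)) (η : ℝ) :
    (Wfun (∏ i, p i) η : ℝ) * polyRho F (∏ i, p i) / (∏ i, p i : ℕ) ≤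
      ((univ.filter fun Y : Finset ι × Finset ι ↦
        |∑ i ∈ Y.1, Real.log (p i) - ∑ i ∈ Y.2, Real.log (p i)| ≤ η).card : ℝ) *
        ∏ i, ((polyRho F (p i) : ℝ) / p i) := by
  rw [mul_div_assoc]
  refine mul_le_mul (by exact_mod_cast Wfun_prod_le hp η) ?_ (by positivity) (by positivity)
  rw [prod_div_distrib]
  push_cast
  gcongr
  exact_mod_cast polyRho_prod_le F hsq

variable {s : Finset ℕ} {b : ℕ → ℕ} {E : ℕ → Finset ℕ}

/-- A squarefree `a` with `b j` prime factors in each `E j` is the product of at least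
`∏ (b j)!` tuples: order the prime factors in each `E j`. -/
lemma prod_factorial_le_card_tuples (hE : ∀ i ∈ s, ∀ j ∈ s, i ≠ j → Disjoint (E i) (E j))
    {a : ℕ} (hsq : Squarefree a) (ha : ∀ p ∈ a.primeFactors, ∃ j ∈ s, p ∈ E j)
    (hb : ∀ j ∈ s, (a.primeFactors.filter (· ∈ E j)).card = b j) :
    ∏ j ∈ s, (b j).factorial ≤
      ((Fintype.piFinset fun i : (j : s) × Fin (b j) ↦ E i.1).filter
        fun p ↦ ∏ i, p i = a).card := by
  set A : s → Finset ℕ := fun j ↦ a.primeFactors.filter (· ∈ E j) with hA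
  have hcard : ∏ j ∈ s, (b j).factorial =
      (univ : Finset ((j : s) → Fin (b j) ≃ A j)).card := by
    rw [card_univ, Fintype.card_pi, ← prod_coe_sort]
    refine prod_congr rfl fun j _ ↦ ?_
    rw [Fintype.card_equiv ((finCongr (hb j j.2).symm).trans (A j).equivFin.symm),
      Fintype.card_fin]
  rw [hcard]
  refine card_le_card_of_injOn (fun e i ↦ (e i.1 i.2 : ℕ)) (fun e _ ↦ ?_) fun e _ e' _ h ↦ ?_
  · rw [mem_coe, mem_filter, Fintype.mem_piFinset]
    refine ⟨fun i ↦ (mem_filter.1 (e i.1 i.2).2).2, ?_⟩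
    rw [Fintype.prod_sigma]
    calc ∏ j : s, ∏ x : Fin (b j), (e j x : ℕ) = ∏ j : s, ∏ q ∈ A j, q := by
          refine prod_congr rfl fun j _ ↦ ?_
          rw [← prod_coe_sort (A j), (e j).prod_comp fun q ↦ (q : ℕ)]
      _ = ∏ q ∈ (univ : Finset s).biUnion A, q := by
          refine (prod_biUnion fun i _ j _ hij ↦ ?_).symm
          exact (disjoint_filter.2 fun q _ hi hj ↦ disjoint_left.1
            (hE i i.2 j j.2 fun h ↦ hij (Subtype.ext h)) hi hj)
      _ = ∏ q ∈ a.primeFactors, q := by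
          congr 1
          ext q
          simp only [mem_biUnion, mem_univ, true_and, hA, mem_filter]
          constructor
          · rintro ⟨j, hq, -⟩
            exact hq
          · intro hq
            obtain ⟨j, hj, hqj⟩ := ha q hq
            exact ⟨⟨j, hj⟩, hq, hqj⟩
      _ = a := Nat.prod_primeFactors_of_squarefree hsq
  · funext j
    ext x
    exact congrFun h ⟨j, x⟩

lemma prod_factorial_mul_sum_le (hE : ∀ i ∈ s, ∀ j ∈ s, i ≠ j → Disjoint (E i) (E j))
    {A : Finset ℕ} (hA : ∀ a ∈ A, Squarefree a ∧ (∀ p ∈ a.primeFactors, ∃ j ∈ s, p ∈ E j) ∧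
      ∀ j ∈ s, (a.primeFactors.filter (· ∈ E j)).card = b j) {G : ℕ → ℝ} (hG : ∀ a, 0 ≤ G a) :
    ((∏ j ∈ s, (b j).factorial : ℕ) : ℝ) * ∑ a ∈ A, G a ≤
      ∑ p ∈ (Fintype.piFinset fun i : (j : s) × Fin (b j) ↦ E i.1) with Squarefree (∏ i, p i),
        G (∏ i, p i) := by
  set S := Fintype.piFinset fun i : (j : s) × Fin (b j) ↦ E i.1
  calc _ = ∑ a ∈ A, ((∏ j ∈ s, (b j).factorial : ℕ) : ℝ) * G a := mul_sum _ _ _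
    _ ≤ ∑ a ∈ A, ∑ p ∈ S with ∏ i, p i = a, G (∏ i, p i) := by
        refine sum_le_sum fun a ha ↦ ?_
        have hc := prod_factorial_le_card_tuples hE (hA a ha).1 (hA a ha).2.1 (hA a ha).2.2
        rw [sum_congr rfl fun p hp ↦ by rw [(mem_filter.1 hp).2], sum_const, nsmul_eq_mul]
        exact mul_le_mul_of_nonneg_right (by exact_mod_cast hc) (hG a)
    _ = ∑ p ∈ S with ∏ i, p i ∈ A, G (∏ i, p i) := by
        rw [← sum_fiberwise_of_maps_to (s := S.filter fun p ↦ ∏ i, p i ∈ A) (t := A)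
          fun p hp ↦ (mem_filter.1 hp).2]
        refine sum_congr rfl fun a ha ↦ ?_
        rw [filter_filter]
        refine sum_congr (filter_congr fun p _ ↦ ?_) fun _ _ ↦ rfl
        exact ⟨fun h ↦ ⟨h ▸ ha, h⟩, And.right⟩
    _ ≤ _ := by
        refine sum_le_sum_of_subset_of_nonneg (fun p hp ↦ ?_) fun p _ _ ↦ hG _
        rw [mem_filter] at hp ⊢
        exact ⟨hp.1, (hA _ hp.2).1⟩

end TupleParametrization

/-! ### The weighted sum over integers with prescribed prime factor counts -/

section AsetSum

open Finset

variable {lam b : ℕ → ℕ} {h m : ℕ}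

lemma finite_Aset (lam b : ℕ → ℕ) (h : ℕ) : (Aset lam h b).Finite := by
  refine (Set.finite_Iic (∏ n ∈ Ioc 0 (lam h), n)).subset fun a ⟨_, hsq, hp, _⟩ ↦ ?_
  refine Nat.le_of_dvd (prod_pos fun n hn ↦ (mem_Ioc.1 hn).1) ?_
  rw [← Nat.prod_primeFactors_of_squarefree hsq]
  exact prod_dvd_prod_of_subset _ _ _ fun p hpa ↦
    mem_Ioc.2 ⟨(Nat.prime_of_mem_primeFactors hpa).pos, (hp p hpa).2⟩

lemma exists_mem_primes_Ioc_of_mem_Aset (hm : ∀ j, 1 ≤ j → j < m → b j = 0) {a : ℕ}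
    (ha : a ∈ Aset lam h b) {p : ℕ} (hp : p ∈ a.primeFactors) :
    ∃ j ∈ Icc m h, p ∈ (Ioc (lam (j - 1)) (lam j)).filter Nat.Prime := by
  obtain ⟨-, -, hrange, hcard⟩ := ha
  obtain ⟨h0, hh⟩ := hrange p hp
  have hex : ∃ j, p ≤ lam j := ⟨h, hh⟩
  have hfind := Nat.find_spec hex
  set j := Nat.find hex with hj
  have hjh : j ≤ h := Nat.find_min' hex hh
  have hj1 : 1 ≤ j := Nat.one_le_iff_ne_zero.2 fun h' ↦ (h' ▸ hfind).not_gt h0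
  have hlt : lam (j - 1) < p := not_le.1 (Nat.find_min hex (by omega))
  refine ⟨j, mem_Icc.2 ⟨?_, hjh⟩, mem_filter.2
    ⟨mem_Ioc.2 ⟨hlt, hfind⟩, Nat.prime_of_mem_primeFactors hp⟩⟩
  by_contra! hjm
  have := hcard j (mem_Icc.2 ⟨hj1, hjh⟩)
  rw [hm j hj1 hjm, card_eq_zero] at this
  exact notMem_empty p (this ▸ mem_filter.2 ⟨hp, hlt, hfind⟩)

lemma disjoint_primes_Ioc (hlam : Monotone lam) {i j : ℕ} (hij : i ≠ j) :
    Disjoint ((Ioc (lam (i - 1)) (lam i)).filter Nat.Prime)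
      ((Ioc (lam (j - 1)) (lam j)).filter Nat.Prime) := by
  wlog hlt : i < j generalizing i j
  · exact (this hij.symm (by omega)).symm
  exact disjoint_filter_filter (Ioc_disjoint_Ioc_of_le (hlam (by omega)))

lemma card_filter_sigma_le {s : Finset ℕ} (b : ℕ → ℕ) (j : ℕ) :
    (univ.filter fun i : (j : s) × Fin (b j) ↦ (i.1 : ℕ) ≤ j).card =
      ∑ i ∈ s.filter (· ≤ j), b i := by
  rw [card_filter, Fintype.sum_sigma, sum_filter, ← sum_coe_sort s]
  exact sum_congr rfl fun i _ ↦ by split_ifs <;> simp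

theorem tsum_Aset_le (F : Polynomial ℤ) (hlam : Monotone lam) (hm1 : 1 ≤ m) (hmh : m ≤ h)
    (hbm : 1 ≤ b m) (hm : ∀ j, 1 ≤ j → j < m → b j = 0) {ℓ : ℝ} (hℓ0 : 0 ≤ ℓ)
    (hℓ : ∀ j, 1 ≤ j →
      ∑ p ∈ (Ioc (lam (j - 1)) (lam j)).filter Nat.Prime, (polyRho F p : ℝ) / p ≤ ℓ)
    {η : ℝ} {T : ℕ → ℝ} (hT0 : ∀ j, 0 ≤ T j)
    (hT : ∀ j, 1 ≤ j → ∀ V : ℝ, ∀ S ⊆ (Ioc (lam (j - 1)) (lam j)).filter Nat.Prime,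
      (∀ n ∈ S, V ≤ n ∧ (n : ℝ) ≤ V * Real.exp (2 * η)) →
      ∑ p ∈ S, (polyRho F p : ℝ) / p ≤ T j) :
    ((∏ j ∈ Icc m h, (b j).factorial : ℕ) : ℝ) *
        ∑' a : (Aset lam h b), (Wfun a η : ℝ) * (polyRho F a : ℝ) / (a : ℝ) ≤
      2 ^ (∑ j ∈ Icc m h, b j) * (ℓ ^ (∑ j ∈ Icc m h, b j) + ℓ ^ (∑ j ∈ Icc m h, b j - 1) *
        ∑ j ∈ Icc m h, T j * 2 ^ (∑ i ∈ Icc m j, b i)) := by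
  set s := Icc m h with hs
  have hs1 : ∀ j ∈ s, 1 ≤ j := fun j hj ↦ hm1.trans (mem_Icc.1 hj).1
  set E : ℕ → Finset ℕ := fun j ↦ (Ioc (lam (j - 1)) (lam j)).filter Nat.Prime with hE
  obtain ⟨A, hA⟩ := (finite_Aset lam b h).exists_finset_coe
  rw [← hA, Finset.tsum_subtype' A fun a ↦ (Wfun a η : ℝ) * (polyRho F a : ℝ) / (a : ℝ)]
  have hAprop : ∀ a ∈ A, Squarefree a ∧ (∀ p ∈ a.primeFactors, ∃ j ∈ s, p ∈ E j) ∧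
      ∀ j ∈ s, (a.primeFactors.filter (· ∈ E j)).card = b j := by
    intro a ha
    have ha' : a ∈ Aset lam h b := hA ▸ mem_coe.2 ha
    refine ⟨ha'.2.1, fun p hp ↦ exists_mem_primes_Ioc_of_mem_Aset hm ha' hp, fun j hj ↦ ?_⟩
    rw [← ha'.2.2.2 j (mem_Icc.2 ⟨hs1 j hj, (mem_Icc.1 hj).2⟩)]
    congr 1
    refine filter_congr fun p hp ↦ ?_
    simp [hE, Nat.prime_of_mem_primeFactors hp]
  refine (prod_factorial_mul_sum_le (fun i _ j _ hij ↦ disjoint_primes_Ioc hlam hij) hAprop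
    fun a ↦ by positivity).trans ?_
  have hprime : ∀ p ∈ Fintype.piFinset fun i : (j : s) × Fin (b j) ↦ E i.1,
      ∀ i, (p i).Prime := fun p hp i ↦ (mem_filter.1 (Fintype.mem_piFinset.1 hp i)).2
  have : Nonempty ((j : s) × Fin (b j)) := ⟨⟨⟨m, mem_Icc.2 ⟨le_rfl, hmh⟩⟩, ⟨0, hbm⟩⟩⟩
  have hmain := sum_piFinset_card_mul_prod_le (P := fun i : (j : s) × Fin (b j) ↦ E i.1)
    (w := fun p ↦ (polyRho F p : ℝ) / p) (J := fun i ↦ i.1) (R := s) (fun _ ↦ by positivity) hℓ0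
    (fun i ↦ hℓ i.1 (hs1 i.1 i.1.2)) (fun i p hp ↦ (mem_filter.1 hp).2.pos) η
    (fun i ↦ i.1.2) hT0 fun i ↦ hT i.1 (hs1 i.1 i.1.2)
  have hk : Fintype.card ((j : s) × Fin (b j)) = ∑ j ∈ s, b j := by
    simp only [Fintype.card_sigma, Fintype.card_fin]
    exact sum_coe_sort s b
  have hB : ∀ j ∈ s, (univ.filter fun i : (j : s) × Fin (b j) ↦ (i.1 : ℕ) ≤ j).card =
      ∑ i ∈ Icc m j, b i := by
    intro j hj
    rw [card_filter_sigma_le]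
    refine sum_congr ?_ fun _ _ ↦ rfl
    ext i
    have := (mem_Icc.1 hj).2
    simp only [hs, mem_filter, mem_Icc]
    omega
  have hsum : ∑ j ∈ s, T j * 2 ^ (univ.filter fun i : (j : s) × Fin (b j) ↦ (i.1 : ℕ) ≤ j).card =
      ∑ j ∈ s, T j * 2 ^ (∑ i ∈ Icc m j, b i) := sum_congr rfl fun j hj ↦ by rw [hB j hj]
  rw [hk, hsum] at hmain
  refine le_trans ?_ hmain
  calc _ ≤ ∑ p ∈ (Fintype.piFinset fun i : (j : s) × Fin (b j) ↦ E i.1) with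
        Squarefree (∏ i, p i), _ := sum_le_sum fun p hp ↦
          Wfun_mul_polyRho_div_le F (hprime p (mem_filter.1 hp).1) (mem_filter.1 hp).2 η
    _ ≤ _ := sum_le_sum_of_subset_of_nonneg (filter_subset _ _) fun p _ _ ↦
          mul_nonneg (by positivity) (prod_nonneg fun i _ ↦ by positivity)

end AsetSum

/-! ### Numerical estimates for the error term -/

section Tail

open Finset Filter Topology

lemma sum_Icc_sqrt_two_pow_le (m j : ℕ) : ∑ i ∈ Icc m j, √2 ^ i ≤ 4 * √2 ^ j := by
  have hs : (4 / 3 : ℝ) ≤ √2 := Real.le_sqrt_of_sq_le (by norm_num)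
  refine (sum_le_sum_of_subset_of_nonneg (t := range (j + 1)) (fun i hi ↦ ?_)
    fun _ _ _ ↦ by positivity).trans ?_
  · exact mem_range.2 (Nat.lt_succ_of_le (mem_Icc.1 hi).2)
  induction j with
  | zero => norm_num
  | succ j ih =>
    have h0 : 0 < √2 ^ j := by positivity
    rw [sum_range_succ, pow_succ]
    nlinarith

lemma sum_Icc_half_pow_le (m h : ℕ) : ∑ j ∈ Icc m h, (1 / 2 : ℝ) ^ j ≤ 2 := by
  have := summable_geometric_two.sum_le_tsum (Icc m h) fun _ _ ↦ by positivity
  rwa [tsum_geometric_two] at this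

lemma exists_forall_mul_exp_le {c : ℝ} (hc : 0 < c) (K : ℝ) : ∃ N : ℕ, ∀ j : ℕ, N ≤ j →
    K * Real.exp (Real.log 2 * (4 * √2 ^ j) - c * 2 ^ j) ≤ 0.005 * (1 / 2) ^ j := by
  have htend : Tendsto (fun j : ℕ ↦ √2 ^ j) atTop atTop :=
    tendsto_pow_atTop_atTop_of_one_lt (Real.lt_sqrt_of_sq_lt (by norm_num))
  have hsmall : ∀ᶠ x : ℝ in atTop, |K| * (x ^ 2 * Real.exp (-x)) < 0.005 := by
    have := (Real.tendsto_pow_mul_exp_neg_atTop_nhds_zero 2).const_mul |K|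
    rw [mul_zero] at this
    exact this.eventually_lt_const (by norm_num)
  have hlarge : ∀ᶠ x : ℝ in atTop, (4 * Real.log 2 + 1) / c ≤ x := eventually_ge_atTop _
  obtain ⟨N, hN⟩ := eventually_atTop.1
    (htend.eventually ((hsmall.and hlarge).and (eventually_gt_atTop 0)))
  refine ⟨N, fun j hj ↦ ?_⟩
  obtain ⟨⟨h1, h2⟩, h0⟩ := hN j hj
  set x := √2 ^ j
  have hx : (2 : ℝ) ^ j = x ^ 2 := by
    rw [← pow_mul, mul_comm, pow_mul, Real.sq_sqrt (by norm_num)]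
  rw [div_le_iff₀ hc] at h2
  rw [one_div, inv_pow, hx, ← div_eq_mul_inv, le_div_iff₀ (by positivity)]
  calc K * Real.exp (Real.log 2 * (4 * x) - c * x ^ 2) * x ^ 2
      ≤ |K| * Real.exp (-x) * x ^ 2 := by
        gcongr
        · exact le_abs_self K
        · nlinarith
    _ = |K| * (x ^ 2 * Real.exp (-x)) := by ring
    _ ≤ _ := h1.le

lemma exists_sum_le_of_le_two_rpow {c K : ℝ} (hc : 0 < c) (hK : 0 ≤ K) :
    ∃ N : ℕ, ∀ (m h : ℕ) (b : ℕ → ℕ), N ≤ m →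
      (∀ j ∈ Icc m h, (b j : ℝ) ≤ (2 : ℝ) ^ ((j : ℝ) / 2)) →
      ∑ j ∈ Icc m h, K * Real.exp (-(c * 2 ^ j)) * 2 ^ (∑ i ∈ Icc m j, b i) ≤ 0.01 := by
  obtain ⟨N, hN⟩ := exists_forall_mul_exp_le hc K
  refine ⟨N, fun m h b hm hb ↦ ?_⟩
  calc ∑ j ∈ Icc m h, K * Real.exp (-(c * 2 ^ j)) * 2 ^ (∑ i ∈ Icc m j, b i)
      ≤ ∑ j ∈ Icc m h, 0.005 * (1 / 2 : ℝ) ^ j := by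
        refine sum_le_sum fun j hj ↦ le_trans ?_ (hN j (hm.trans (mem_Icc.1 hj).1))
        have hB : ((∑ i ∈ Icc m j, b i : ℕ) : ℝ) ≤ 4 * √2 ^ j := by
          rw [Nat.cast_sum]
          refine (sum_le_sum fun i hi ↦ ?_).trans (sum_Icc_sqrt_two_pow_le m j)
          refine (hb i (Icc_subset_Icc_right (mem_Icc.1 hj).2 hi)).trans_eq ?_
          rw [Real.sqrt_eq_rpow, ← Real.rpow_mul_natCast (by norm_num)]
          congr 1
          ring
        have hpow : (2 : ℝ) ^ (∑ i ∈ Icc m j, b i) ≤ Real.exp (Real.log 2 * (4 * √2 ^ j)) := by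
          rw [← Real.rpow_natCast, Real.rpow_def_of_pos two_pos]
          gcongr
        rw [mul_assoc, sub_eq_neg_add, Real.exp_add]
        gcongr
    _ = 0.005 * ∑ j ∈ Icc m h, (1 / 2 : ℝ) ^ j := by rw [mul_sum]
    _ ≤ 0.01 := by linarith [sum_Icc_half_pow_le m h]

end Tail

theorem stmt9 (F : Polynomial ℤ) (hF : Irreducible F) (hdeg : 2 ≤ F.natDegree) :
    ∃ (D : ℕ) (M c : ℝ), 2 ≤ D ∧ 0 < M ∧ 0 < c ∧
      (∀ p : ℕ, p.Prime → D < p → (polyRho F p : ℝ) / p ≤ Real.log 2) ∧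
      ∀ lam : ℕ → ℕ,
        (lam 0 = D ∧
          ∀ j : ℕ, 1 ≤ j →
            ((lam j).Prime ∧ lam (j - 1) < lam j ∧
              ∑ p ∈ (Finset.Ioc (lam (j - 1)) (lam j)).filter Nat.Prime,
                  (polyRho F p : ℝ) / p ≤ Real.log 2) ∧
            (∀ q : ℕ, q.Prime → lam (j - 1) < q →
              (∑ p ∈ (Finset.Ioc (lam (j - 1)) q).filter Nat.Prime,
                  (polyRho F p : ℝ) / p ≤ Real.log 2) → q ≤ lam j)) →
        ∀ (η : ℝ) (h : ℕ) (b : ℕ → ℕ) (m k : ℕ),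
          0 < η → 1 ≤ h →
          (∃ j ∈ Finset.Icc 1 h, 1 ≤ b j) →
          (m ∈ Finset.Icc 1 h ∧ 1 ≤ b m ∧ ∀ j, 1 ≤ j → j < m → b j = 0) →
          k = ∑ j ∈ Finset.Icc m h, b j →
          (η < 1 → M ≤ (m : ℝ) ∧ ∀ j ∈ Finset.Icc 1 h, (b j : ℝ) ≤ (2 : ℝ) ^ ((j : ℝ) / 2)) →
          ∑' a : (Aset lam h b), (Wfun a η : ℝ) * (polyRho F a : ℝ) / (a : ℝ) ≤
            ((2 * Real.log 2) ^ k / ((∏ j ∈ Finset.Icc m h, Nat.factorial (b j) : ℕ) : ℝ)) *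
              (1.01 + c * η *
                ∑ j ∈ Finset.Icc m h,
                  (2 : ℝ) ^ (-(j : ℝ) + ∑ i ∈ Finset.Icc m j, (b i : ℝ))) := by
  obtain ⟨g, hg⟩ : ∃ g : ℝ, g = F.natDegree := ⟨_, rfl⟩
  have hg2 : 2 ≤ g := by rw [hg]; exact_mod_cast hdeg
  have hg0 : 0 < g := by linarith
  have hw : ∀ p : ℕ, p.Prime → (polyRho F p : ℝ) / p ≤ g / p := fun p hp ↦ by
    rw [hg]
    gcongr
    exact_mod_cast polyRho_prime_le_natDegree (hF.isPrimitive (by omega)) hp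
  obtain ⟨C, hC⟩ := exists_sum_polyRho_div_le hF (by omega)
  obtain ⟨c₀, hc₀, hgrowth⟩ := exists_mul_two_pow_le_log (w := fun p ↦ (polyRho F p : ℝ) / p)
    (fun _ ↦ by positivity) hw (by positivity) hC
  have hlog2 : 0.69 < Real.log 2 := by linarith [Real.log_two_gt_d9]
  obtain ⟨N, hN⟩ := exists_sum_le_of_le_two_rpow (c := c₀ / 4) (K := 2 * g / Real.log 2)
    (by positivity) (by positivity)
  refine ⟨4 * F.natDegree, N + 1, 4000 * g / (c₀ * Real.log 2), by omega, by positivity,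
    by positivity, fun p hp hDp ↦ ?_, ?_⟩
  · have hp4 : 4 * g < p := by rw [hg]; exact_mod_cast hDp
    refine (hw p hp).trans ?_
    rw [div_le_iff₀ (by linarith)]
    nlinarith
  rintro lam ⟨hlam0, hlam⟩ η h b m k hη - - ⟨hmh, hbm, hm⟩ rfl hcond
  rw [Finset.mem_Icc] at hmh
  have hlt : ∀ j, lam j < lam (j + 1) := fun j ↦ by simpa using (hlam (j + 1) (by omega)).1.2.1
  have hmono : Monotone lam := (strictMono_nat_of_lt_succ hlt).monotone
  have hlam2 : ∀ j, 2 ≤ lam j := fun j ↦ by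
    have := hmono (Nat.zero_le j)
    omega
  have hlog : ∀ j, 1 ≤ j → c₀ * 2 ^ j / 2 ≤ Real.log (lam (j - 1)) := by
    intro j hj
    obtain ⟨i, rfl⟩ := Nat.exists_eq_add_of_le' hj
    refine le_trans (le_of_eq ?_) (hgrowth lam (hlam2 0) (by rw [hlam0, hg]; push_cast; rfl) hlt
      (fun j q hq hjq hsum ↦ (hlam (j + 1) (by omega)).2 q hq (by simpa using hjq)
        (by simpa using hsum)) (i + 1 - 1))
    rw [Nat.add_sub_cancel, pow_succ]
    ring
  set T : ℕ → ℝ := fun j ↦ g * (2000 * η / Real.log (lam (j - 1)) +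
    if η < 1 then 2 / √(lam (j - 1)) else 0) with hT
  have hlogpos : ∀ j, 0 < Real.log (lam j) := fun j ↦
    Real.log_pos (by exact_mod_cast hlam2 j)
  have hmain := tsum_Aset_le (lam := lam) (b := b) (h := h) (m := m) (η := η) (T := T) F hmono
    hmh.1 hmh.2 hbm hm (ℓ := Real.log 2) (by positivity) (fun j hj ↦ (hlam j hj).1.2.2)
    (fun j ↦ by have := hlogpos (j - 1); simp only [hT]; split_ifs <;> positivity) (by
      intro j hj V S hS hwin
      calc ∑ p ∈ S, (polyRho F p : ℝ) / p ≤ ∑ p ∈ S, g * (1 / p) :=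
            Finset.sum_le_sum fun p hp ↦ by
              rw [mul_one_div]
              exact hw p (Finset.mem_filter.1 (hS hp)).2
        _ = g * ∑ p ∈ S, (1 : ℝ) / p := by rw [Finset.mul_sum]
        _ ≤ T j := mul_le_mul_of_nonneg_left (sum_inv_primes_window (hlam2 (j - 1)) hη S
            fun p hp ↦ ⟨(Finset.mem_filter.1 (hS hp)).2,
              (Finset.mem_Ioc.1 (Finset.mem_filter.1 (hS hp)).1).1, hwin p hp⟩) (by positivity))
  have hk : 1 ≤ ∑ j ∈ Finset.Icc m h, b j :=
    hbm.trans (Finset.single_le_sum (fun _ _ ↦ Nat.zero_le _) (Finset.mem_Icc.2 ⟨le_rfl, hmh.2⟩))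
  set k := ∑ j ∈ Finset.Icc m h, b j
  have hbound : (Real.log 2)⁻¹ * ∑ j ∈ Finset.Icc m h, T j * 2 ^ (∑ i ∈ Finset.Icc m j, b i) ≤
      0.01 + 4000 * g / (c₀ * Real.log 2) * η *
        ∑ j ∈ Finset.Icc m h, (2 : ℝ) ^ (-(j : ℝ) + ∑ i ∈ Finset.Icc m j, (b i : ℝ)) := by
    have hsmall : ∑ j ∈ Finset.Icc m h, (Real.log 2)⁻¹ *
        (g * if η < 1 then 2 / √(lam (j - 1)) else 0) * 2 ^ (∑ i ∈ Finset.Icc m j, b i) ≤ 0.01 := by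
      split_ifs with hη1
      · obtain ⟨hMm, hb⟩ := hcond hη1
        refine le_trans (Finset.sum_le_sum fun j hj ↦ ?_) (hN m h b ?_ fun j hj ↦ hb j ?_)
        · have hj1 : 1 ≤ j := hmh.1.trans (Finset.mem_Icc.1 hj).1
          have hpos : (0 : ℝ) < lam (j - 1) := by
            exact_mod_cast lt_of_lt_of_le two_pos (hlam2 (j - 1))
          have hsqrt : (√(lam (j - 1) : ℝ))⁻¹ ≤ Real.exp (-(c₀ / 4 * 2 ^ j)) := by
            rw [Real.exp_neg]
            refine inv_anti₀ (Real.exp_pos _) (Real.le_sqrt_of_sq_le ?_)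
            rw [← Real.exp_nat_mul, ← Real.le_log_iff_exp_le hpos]
            refine le_trans (le_of_eq ?_) (hlog j hj1)
            push_cast
            ring
          calc _ = 2 * g / Real.log 2 * (√(lam (j - 1) : ℝ))⁻¹ *
                2 ^ (∑ i ∈ Finset.Icc m j, b i) := by ring
            _ ≤ _ := by gcongr
        · have : (N : ℝ) ≤ m := by linarith
          exact_mod_cast this
        · exact Finset.Icc_subset_Icc_left hmh.1 hj
      · simp
        norm_num
    have hlarge : ∑ j ∈ Finset.Icc m h, (Real.log 2)⁻¹ *
        (g * (2000 * η / Real.log (lam (j - 1)))) * 2 ^ (∑ i ∈ Finset.Icc m j, b i) ≤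
        4000 * g / (c₀ * Real.log 2) * η *
          ∑ j ∈ Finset.Icc m h, (2 : ℝ) ^ (-(j : ℝ) + ∑ i ∈ Finset.Icc m j, (b i : ℝ)) := by
      rw [Finset.mul_sum]
      refine Finset.sum_le_sum fun j hj ↦ ?_
      have hj1 : 1 ≤ j := hmh.1.trans (Finset.mem_Icc.1 hj).1
      rw [Real.rpow_add two_pos, Real.rpow_neg two_pos.le, Real.rpow_natCast, ← Nat.cast_sum,
        Real.rpow_natCast, ← mul_assoc (4000 * g / (c₀ * Real.log 2) * η)]
      refine mul_le_mul_of_nonneg_right ?_ (by positivity)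
      calc _ ≤ (Real.log 2)⁻¹ * (g * (2000 * η / (c₀ * 2 ^ j / 2))) := by
            have := hlog j hj1
            gcongr
        _ = _ := by field_simp; norm_num
    refine le_trans (le_of_eq ?_) (add_le_add hsmall hlarge)
    rw [Finset.mul_sum, ← Finset.sum_add_distrib]
    refine Finset.sum_congr rfl fun j _ ↦ ?_
    simp only [hT]
    ring
  have hfact : (0 : ℝ) < ((∏ j ∈ Finset.Icc m h, (b j).factorial : ℕ) : ℝ) :=
    Nat.cast_pos.2 (Finset.prod_pos fun j _ ↦ Nat.factorial_pos _)
  rw [div_mul_eq_mul_div, le_div_iff₀ hfact, mul_comm]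
  refine hmain.trans ?_
  have hpow : Real.log 2 ^ (k - 1) = Real.log 2 ^ k * (Real.log 2)⁻¹ := by
    rw [← pow_sub_one_mul (show k ≠ 0 by omega), mul_assoc,
      mul_inv_cancel₀ (show Real.log 2 ≠ 0 by positivity), mul_one]
  rw [hpow, mul_assoc (Real.log 2 ^ k), ← mul_one_add, ← mul_assoc, ← mul_pow]
  exact mul_le_mul_of_nonneg_left (by linarith) (by positivity)
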